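/- arXiv:2504.15014 — 2 statements merged into one kernel-verified Lean document; each statement's English description precedes it below -/
import Mathlib

section
/- The fourth homotopy group of the special unitary group SU(8), based at the identity matrix, is trivial: π₄(SU(8), 1) is a subsingleton. -/
open scoped Topology

namespace StableGL

open scoped unitInterval

section Basic

variable {X Y : Type*} [TopologicalSpace X] [TopologicalSpace Y]
variable {ι κ ν : Type} [Fintype ι] [DecidableEq ι] [Fintype κ] [DecidableEq κ]
  [Fintype ν] [DecidableEq ν]

/-- A map into the group of units of a complex matrix ring is continuous as soon as the underlying
matrix-valued map is. -/
theorem continuous_of_val {f : X → (Matrix ι ι ℂ)ˣ}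
    (h : Continuous fun x => (f x : Matrix ι ι ℂ)) : Continuous f := by
  refine Units.continuous_iff.2 ⟨h, ?_⟩
  have hdet : ∀ x, (f x : Matrix ι ι ℂ).det ≠ 0 := fun x =>
    ((Matrix.isUnit_iff_isUnit_det _).1 (f x).isUnit).ne_zero
  have : (fun x => ((f x)⁻¹ : (Matrix ι ι ℂ)ˣ).val) =
      fun x => ((f x : Matrix ι ι ℂ).det)⁻¹ • (f x : Matrix ι ι ℂ).adjugate := by
    funext x
    rw [Matrix.coe_units_inv, Matrix.inv_def, Ring.inverse_eq_inv']
  rw [this]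
  exact (h.matrix_det.inv₀ hdet).smul h.matrix_adjugate

/-- A continuous family of invertible matrices, as a continuous map into the group of units. -/
noncomputable def unitsMk (F : X → Matrix ι ι ℂ) (hF : Continuous F) (hu : ∀ x, IsUnit (F x)) :
    C(X, (Matrix ι ι ℂ)ˣ) :=
  ⟨fun x => (hu x).unit, continuous_of_val (by simpa using hF)⟩

@[simp]
theorem unitsMk_apply (F : X → Matrix ι ι ℂ) (hF : Continuous F) (hu : ∀ x, IsUnit (F x)) (x : X) :
    (unitsMk F hF hu x : Matrix ι ι ℂ) = F x := rfl

/-- A continuous monoid homomorphism between matrix rings induces one between their units. -/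
def unitsHom (φ : Matrix ι ι ℂ →* Matrix ν ν ℂ) (hφ : Continuous φ) :
    (Matrix ι ι ℂ)ˣ →ₜ* (Matrix ν ν ℂ)ˣ where
  toMonoidHom := Units.map φ
  continuous_toFun := continuous_of_val (hφ.comp Units.continuous_val)

@[simp]
theorem unitsHom_apply (φ : Matrix ι ι ℂ →* Matrix ν ν ℂ) (hφ : Continuous φ)
    (A : (Matrix ι ι ℂ)ˣ) : (unitsHom φ hφ A : Matrix ν ν ℂ) = φ A := rfl

/-- The stabilization `A ↦ A ⊕ 1`. -/
def stab (ι κ : Type) [Fintype ι] [DecidableEq ι] [Fintype κ] [DecidableEq κ] :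
    (Matrix ι ι ℂ)ˣ →ₜ* (Matrix (ι ⊕ κ) (ι ⊕ κ) ℂ)ˣ :=
  unitsHom
    { toFun := fun A => Matrix.fromBlocks A 0 0 1
      map_one' := Matrix.fromBlocks_one
      map_mul' := fun A B => by simp [Matrix.fromBlocks_multiply] }
    (continuous_id.matrix_fromBlocks continuous_const continuous_const continuous_const)

@[simp]
theorem stab_apply (A : (Matrix ι ι ℂ)ˣ) :
    (stab ι κ A : Matrix (ι ⊕ κ) (ι ⊕ κ) ℂ) = Matrix.fromBlocks A 0 0 1 := rfl

/-- Reindexing of invertible matrices along an equivalence of index types. -/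
def reindexHom (e : ι ≃ ν) : (Matrix ι ι ℂ)ˣ →ₜ* (Matrix ν ν ℂ)ˣ :=
  unitsHom (Matrix.reindexAlgEquiv ℂ ℂ e).toAlgHom.toRingHom.toMonoidHom
    (continuous_id.matrix_reindex e e)

@[simp]
theorem reindexHom_apply (e : ι ≃ ν) (A : (Matrix ι ι ℂ)ˣ) :
    (reindexHom e A : Matrix ν ν ℂ) = (A : Matrix ι ι ℂ).submatrix e.symm e.symm := rfl

/-- A family of invertible matrices is stably null relative to `S` if it becomes homotopic to the
constant family `1`, relative to `S`, after adding an identity block. -/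
def StablyNull (S : Set X) (f : C(X, (Matrix ι ι ℂ)ˣ)) : Prop :=
  ∃ (κ : Type) (_ : Fintype κ) (_ : DecidableEq κ),
    ((stab ι κ).toContinuousMap.comp f).HomotopicRel 1 S

theorem homotopicRel_comp_one {S : Set X} {G H : Type*} [TopologicalSpace G] [TopologicalSpace H]
    [Group G] [Group H] [IsTopologicalGroup G] [IsTopologicalGroup H]
    {f : C(X, G)} (hf : f.HomotopicRel 1 S) (φ : G →ₜ* H) :
    (φ.toContinuousMap.comp f).HomotopicRel 1 S := by
  have := hf.comp_continuousMap φ.toContinuousMap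
  have h1 : (φ.toContinuousMap.comp (1 : C(X, G))) = 1 := by ext x; simp
  rwa [h1] at this

theorem StablyNull.of_homotopicRel {S : Set X} {f g : C(X, (Matrix ι ι ℂ)ˣ)}
    (h : f.HomotopicRel g S) (hg : StablyNull S g) : StablyNull S f := by
  obtain ⟨κ, i1, i2, h'⟩ := hg
  exact ⟨κ, i1, i2, (h.comp_continuousMap _).trans h'⟩

theorem StablyNull.of_reindex {S : Set X} {f : C(X, (Matrix ι ι ℂ)ˣ)} (e : ι ≃ ν)
    (h : StablyNull S ((reindexHom e).toContinuousMap.comp f)) : StablyNull S f := by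
  obtain ⟨κ, i1, i2, h⟩ := h
  refine ⟨κ, i1, i2, ?_⟩
  convert! homotopicRel_comp_one h (reindexHom (Equiv.sumCongr e (Equiv.refl κ)).symm) using 1
  ext x i j
  rcases i with i | i <;> rcases j with j | j <;> simp

theorem StablyNull.of_stab {S : Set X} {f : C(X, (Matrix ι ι ℂ)ˣ)}
    (h : StablyNull S ((stab ι κ).toContinuousMap.comp f)) : StablyNull S f := by
  obtain ⟨κ', i1, i2, h⟩ := h
  refine ⟨κ ⊕ κ', inferInstance, inferInstance, ?_⟩
  convert! homotopicRel_comp_one h (reindexHom (Equiv.sumAssoc ι κ κ')) using 1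
  ext x i j
  rcases i with i | i | i <;> rcases j with j | j | j <;> simp [Matrix.one_apply]

/-- All families over `X` that are trivial on `S` are stably null. -/
def AllStablyNull (X : Type*) [TopologicalSpace X] (S : Set X) : Prop :=
  ∀ (ι : Type) [Fintype ι] [DecidableEq ι] (f : C(X, (Matrix ι ι ℂ)ˣ)),
    (∀ x ∈ S, f x = 1) → StablyNull S f

/-- Pulling back null-homotopies along a map of pairs. -/
theorem HomotopicRel.comp_right {S : Set X} {T : Set Y} {Z : Type*} [TopologicalSpace Z]
    {f g : C(X, Z)} (h : f.HomotopicRel g S) (q : C(Y, X)) (hq : ∀ y ∈ T, q y ∈ S) :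
    (f.comp q).HomotopicRel (g.comp q) T := by
  obtain ⟨H⟩ := h
  exact ⟨{ toFun := fun p => H (p.1, q p.2)
           map_zero_left := by simp
           map_one_left := by simp
           prop' := fun t y hy => H.prop' t (q y) (hq y hy) }⟩

end Basic

section Normalization

variable {X : Type*} [TopologicalSpace X]
variable {ι κ ν : Type} [Fintype ι] [DecidableEq ι] [Fintype κ] [DecidableEq κ]
  [Fintype ν] [DecidableEq ν]

/-- The normalization of a family of loops `F`: it is `1` at `z = 1` and at `x = x₀`, and it only
depends on `F` up to left multiplication by functions of `x` and right multiplication by functions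
of `z` that are `1` at `1`. -/
noncomputable def nrm {G : Type*} [TopologicalSpace G] [Group G] [IsTopologicalGroup G] (x₀ : X)
    (F : C(X × Circle, G)) : C(X × Circle, G) where
  toFun p := (F (p.1, 1))⁻¹ * F p * (F (x₀, p.2))⁻¹ * F (x₀, 1)
  continuous_toFun := by fun_prop

theorem nrm_apply {G : Type*} [TopologicalSpace G] [Group G] [IsTopologicalGroup G] (x₀ : X)
    (F : C(X × Circle, G)) (p : X × Circle) :
    nrm x₀ F p = (F (p.1, 1))⁻¹ * F p * (F (x₀, p.2))⁻¹ * F (x₀, 1) := rfl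

/-- The subspace `A × S¹ ∪ X × {1}`. -/
def wedge (A : Set X) : Set (X × Circle) := {p | p.1 ∈ A ∨ p.2 = 1}

/-- The normalized family of loops is stably null. -/
def Good (x₀ : X) (A : Set X) (F : C(X × Circle, (Matrix ι ι ℂ)ˣ)) : Prop :=
  StablyNull (wedge A) (nrm x₀ F)

variable {x₀ : X} {A : Set X}

theorem Good.stablyNull {F : C(X × Circle, (Matrix ι ι ℂ)ˣ)} (h : Good x₀ A F) (hx₀ : x₀ ∈ A)
    (hF : ∀ p ∈ wedge A, F p = 1) : StablyNull (wedge A) F := by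
  have : nrm x₀ F = F := by
    ext1 p
    rw [nrm_apply, hF (p.1, 1) (Or.inr rfl), hF (x₀, p.2) (Or.inl hx₀), hF (x₀, 1) (Or.inl hx₀)]
    simp
  rwa [Good, this] at h

theorem Good.of_homotopy {F F' : C(X × Circle, (Matrix ι ι ℂ)ˣ)} (h : Good x₀ A F')
    (H : I × X × Circle → Matrix ι ι ℂ) (hH : Continuous H) (hu : ∀ p, IsUnit (H p))
    (h0 : ∀ p, H (0, p) = F p) (h1 : ∀ p, H (1, p) = F' p)
    (hA : ∀ t, ∀ x ∈ A, ∀ z, H (t, x, z) = H (t, x₀, z)) : Good x₀ A F := by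
  have hc := (unitsMk H hH hu).continuous
  have e0 : ∀ p, unitsMk H hH hu (0, p) = F p := fun p => Units.ext (h0 p)
  have e1 : ∀ p, unitsMk H hH hu (1, p) = F' p := fun p => Units.ext (h1 p)
  have eA : ∀ t, ∀ x ∈ A, ∀ z, unitsMk H hH hu (t, x, z) = unitsMk H hH hu (t, x₀, z) :=
    fun t x hx z => Units.ext (hA t x hx z)
  refine StablyNull.of_homotopicRel ?_ h
  generalize unitsMk H hH hu = K at hc e0 e1 eA
  have key : ∀ t, ∀ p ∈ wedge A, (K (t, p.1, 1))⁻¹ * K (t, p) * (K (t, x₀, p.2))⁻¹ * K (t, x₀, 1)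
      = 1 := by
    rintro t ⟨x, z⟩ (hx | hz)
    · simp only at hx
      simp [eA t x hx]
    · simp only at hz
      simp [hz]
  refine ⟨{ toFun := fun p => (K (p.1, p.2.1, 1))⁻¹ * K p * (K (p.1, x₀, p.2.2))⁻¹ * K (p.1, x₀, 1)
            continuous_toFun := by fun_prop
            map_zero_left := fun p => by simp [nrm_apply, e0]
            map_one_left := fun p => by simp [nrm_apply, e1]
            prop' := fun t p hp => ?_ }⟩
  have k0 := key 0 p hp
  simp only [e0] at k0
  simpa [nrm_apply, k0] using key t p hp

theorem Good.of_map {F : C(X × Circle, (Matrix ι ι ℂ)ˣ)}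
    (φ : (Matrix ι ι ℂ)ˣ →ₜ* (Matrix ν ν ℂ)ˣ)
    (hφ : ∀ f : C(X × Circle, (Matrix ι ι ℂ)ˣ), StablyNull (wedge A) (φ.toContinuousMap.comp f) →
      StablyNull (wedge A) f)
    (h : Good x₀ A (φ.toContinuousMap.comp F)) : Good x₀ A F := by
  refine hφ _ ?_
  have : φ.toContinuousMap.comp (nrm x₀ F) = nrm x₀ (φ.toContinuousMap.comp F) := by
    ext1 p
    simp [nrm_apply]
  rwa [this]

theorem Good.of_reindex {F : C(X × Circle, (Matrix ι ι ℂ)ˣ)} (e : ι ≃ ν)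
    (h : Good x₀ A ((reindexHom e).toContinuousMap.comp F)) : Good x₀ A F :=
  Good.of_map _ (fun _ => StablyNull.of_reindex e) h

theorem Good.of_stab {F : C(X × Circle, (Matrix ι ι ℂ)ˣ)}
    (h : Good x₀ A ((stab ι κ).toContinuousMap.comp F)) : Good x₀ A F :=
  Good.of_map _ (fun _ => StablyNull.of_stab) h

theorem Good.of_conj {F F' : C(X × Circle, (Matrix ι ι ℂ)ˣ)} (b : (Matrix ι ι ℂ)ˣ)
    (hF : ∀ p, F' p = b * F p * b⁻¹) (h : Good x₀ A F') : Good x₀ A F := by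
  refine Good.of_map ⟨(MulAut.conj b).toMonoidHom, by
    change Continuous fun c => b * c * b⁻¹
    fun_prop⟩ (fun f hf => ?_) (F := F) ?_
  · obtain ⟨κ, i1, i2, hf⟩ := hf
    refine ⟨κ, i1, i2, ?_⟩
    convert! homotopicRel_comp_one hf ⟨(MulAut.conj (stab ι κ b⁻¹)).toMonoidHom, by
      change Continuous fun c => stab ι κ b⁻¹ * c * (stab ι κ b⁻¹)⁻¹
      fun_prop⟩ using 1
    ext1 p
    change stab ι κ (f p) = stab ι κ b⁻¹ * stab ι κ (b * f p * b⁻¹) * (stab ι κ b⁻¹)⁻¹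
    rw [← map_inv, ← map_mul, ← map_mul]
    congr 1
    group
  · convert! h using 1
    ext1 p
    exact (hF p).symm

theorem Good.of_mul {F F' : C(X × Circle, (Matrix ι ι ℂ)ˣ)} (a : X → (Matrix ι ι ℂ)ˣ)
    (g : Circle → (Matrix ι ι ℂ)ˣ) (hg : g 1 = 1)
    (hF : ∀ p, F' p = a p.1 * F p * g p.2) (h : Good x₀ A F') :
    Good x₀ A F := by
  have : nrm x₀ F' = nrm x₀ F := by
    ext1 p
    simp only [nrm_apply, hF, hg]
    group
  rwa [Good, this] at h

end Normalization

section Higman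

variable {X : Type*} {ι : Type} [DecidableEq ι]

/-- The coefficients of Higman's linearization. -/
def higman (a : ℕ → X → Matrix ι ι ℂ) (k : ℕ) (x : X) : Matrix (ι ⊕ ι) (ι ⊕ ι) ℂ :=
  Matrix.fromBlocks (if k = 0 then a 0 x else 0) (a (k + 1) x) (if k = 1 then -1 else 0)
    (if k = 0 then 1 else 0)

theorem sum_higman (a : ℕ → X → Matrix ι ι ℂ) (d : ℕ) (x : X) (z : ℂ) :
    ∑ k ∈ Finset.range (d + 2), z ^ k • higman a k x =
      Matrix.fromBlocks (a 0 x) (∑ k ∈ Finset.range (d + 2), z ^ k • a (k + 1) x)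
        (-(z • (1 : Matrix ι ι ℂ))) 1 := by
  simp only [Finset.sum_range_succ' _ (d + 1), Finset.sum_range_succ' _ d]
  ext i j
  rcases i with i | i <;> rcases j with j | j <;> simp [Matrix.sum_apply, higman]

end Higman

section Linearization

variable {X : Type*} [TopologicalSpace X]
variable {ι κ : Type} [Fintype ι] [DecidableEq ι] [Fintype κ] [DecidableEq κ]

theorem isUnit_fromBlocks_upper (B : Matrix ι κ ℂ) :
    IsUnit (Matrix.fromBlocks (1 : Matrix ι ι ℂ) B 0 (1 : Matrix κ κ ℂ)) :=
  Matrix.isUnit_fromBlocks_zero₂₁.2 ⟨isUnit_one, isUnit_one⟩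

theorem isUnit_fromBlocks_lower (B : Matrix κ ι ℂ) :
    IsUnit (Matrix.fromBlocks (1 : Matrix ι ι ℂ) 0 B (1 : Matrix κ κ ℂ)) :=
  Matrix.isUnit_fromBlocks_zero₁₂.2 ⟨isUnit_one, isUnit_one⟩

/-- Families of loops that are linear in `z` are good. -/
def LinearGood (x₀ : X) (A : Set X) : Prop :=
  ∀ (ι : Type) [Fintype ι] [DecidableEq ι] (a b : X → Matrix ι ι ℂ)
    (hF : Continuous fun p : X × Circle => a p.1 + (p.2 : ℂ) • b p.1)
    (hu : ∀ p : X × Circle, IsUnit (a p.1 + (p.2 : ℂ) • b p.1)),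
    Continuous a → Continuous b → (∀ x ∈ A, a x = a x₀) → (∀ x ∈ A, b x = b x₀) →
    Good x₀ A (unitsMk _ hF hu)

theorem good_polynomial {x₀ : X} {A : Set X} (hlin : LinearGood x₀ A) (d : ℕ) :
    ∀ (ι : Type) [Fintype ι] [DecidableEq ι] (a : ℕ → X → Matrix ι ι ℂ)
      (hF : Continuous fun p : X × Circle =>
        ∑ k ∈ Finset.range (d + 2), (p.2 : ℂ) ^ k • a k p.1)
      (hu : ∀ p : X × Circle, IsUnit (∑ k ∈ Finset.range (d + 2), (p.2 : ℂ) ^ k • a k p.1)),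
      (∀ k, Continuous (a k)) → (∀ k, ∀ x ∈ A, a k x = a k x₀) → Good x₀ A (unitsMk _ hF hu) := by
  induction d with
  | zero =>
    intro ι _ _ a hF hu ha hA
    have e : (fun p : X × Circle => ∑ k ∈ Finset.range (0 + 2), (p.2 : ℂ) ^ k • a k p.1) =
        fun p => a 0 p.1 + (p.2 : ℂ) • a 1 p.1 := by
      funext p
      simp [Finset.sum_range_succ]
    have := hlin ι (a 0) (a 1) (e ▸ hF) (fun p => by simpa [Finset.sum_range_succ] using hu p)
      (ha 0) (ha 1) (hA 0) (hA 1)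
    convert! this using 1
    ext1 p
    exact Units.ext (congrFun e p)
  | succ d ih =>
    intro ι _ _ a hF hu ha hA
    set P : X × Circle → Matrix ι ι ℂ :=
      fun p => ∑ k ∈ Finset.range (d + 1 + 2), (p.2 : ℂ) ^ k • a k p.1 with hP
    set q : X × Circle → Matrix ι ι ℂ :=
      fun p => ∑ k ∈ Finset.range (d + 2), (p.2 : ℂ) ^ k • a (k + 1) p.1 with hq
    have hqc : Continuous q := by
      refine continuous_finsetSum _ fun k _ => ?_
      exact ((continuous_subtype_val.comp continuous_snd).pow k).smul ((ha _).comp continuous_fst)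
    have hPq : ∀ p, P p = a 0 p.1 + (p.2 : ℂ) • q p := by
      intro p
      simp only [hP, hq]
      rw [Finset.sum_range_succ', add_comm, Finset.smul_sum]
      simp [pow_succ', mul_smul]
    let H : I × X × Circle → Matrix (ι ⊕ ι) (ι ⊕ ι) ℂ := fun p =>
      Matrix.fromBlocks 1 (((p.1 : ℝ) : ℂ) • q p.2) 0 1 * Matrix.fromBlocks (P p.2) 0 0 1 *
        Matrix.fromBlocks 1 0 (-(((p.1 : ℝ) : ℂ) • (p.2.2 : ℂ) • (1 : Matrix ι ι ℂ))) 1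
    have hHu : ∀ p, IsUnit (H p) := fun p =>
      ((isUnit_fromBlocks_upper _).mul
        (Matrix.isUnit_fromBlocks_zero₂₁.2 ⟨hu p.2, isUnit_one⟩)).mul (isUnit_fromBlocks_lower _)
    have hHc : Continuous H := by
      have ht : Continuous fun p : I × X × Circle => (((p.1 : ℝ) : ℂ)) := by fun_prop
      have hz : Continuous fun p : I × X × Circle => (p.2.2 : ℂ) := by fun_prop
      refine ((continuous_const.matrix_fromBlocks (ht.smul (hqc.comp continuous_snd))
        continuous_const continuous_const).mul ((hF.comp continuous_snd).matrix_fromBlocks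
        continuous_const continuous_const continuous_const)).mul
        (continuous_const.matrix_fromBlocks continuous_const
          (ht.smul (hz.smul continuous_const)).neg continuous_const)
    have hH1 : ∀ p, H (1, p) = ∑ k ∈ Finset.range (d + 2), (p.2 : ℂ) ^ k • higman a k p.1 := by
      intro p
      rw [sum_higman]
      simp only [H, Matrix.fromBlocks_multiply]
      simp [hPq, hq]
    have hhc : ∀ k, Continuous (higman a k) := fun k => by
      refine Continuous.matrix_fromBlocks ?_ (ha _) continuous_const continuous_const
      split_ifs
      exacts [ha 0, continuous_const]
    have hMc : Continuous fun p : X × Circle =>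
        ∑ k ∈ Finset.range (d + 2), (p.2 : ℂ) ^ k • higman a k p.1 := by
      simp only [← hH1]
      exact hHc.comp (by fun_prop)
    have hMu : ∀ p : X × Circle,
        IsUnit (∑ k ∈ Finset.range (d + 2), (p.2 : ℂ) ^ k • higman a k p.1) := fun p => by
      rw [← hH1]
      exact hHu _
    have good := ih (ι ⊕ ι) (higman a) hMc hMu hhc
      (fun k x hx => by simp only [higman, hA _ x hx])
    refine Good.of_stab (κ := ι) (good.of_homotopy H hHc hHu (fun p => ?_) hH1 ?_)
    · simp [H, hP]
    · intro t x hx z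
      have e : ∀ k, a k x = a k x₀ := fun k => hA k x hx
      simp only [H, hP, hq, e]

end Linearization

section Lyapunov

open Matrix

variable {ι κ : Type*} [Fintype ι] [Fintype κ]

/-- A complex matrix with positive definite Hermitian part. -/
def Accretive (M : Matrix ι ι ℂ) : Prop := ∀ v : ι → ℂ, v ≠ 0 → 0 < (star v ⬝ᵥ M *ᵥ v).re

theorem Accretive.isUnit [DecidableEq ι] {M : Matrix ι ι ℂ} (h : Accretive M) : IsUnit M := by
  rw [Matrix.isUnit_iff_isUnit_det, isUnit_iff_ne_zero]
  intro h0
  obtain ⟨v, hv, hM⟩ := Matrix.exists_mulVec_eq_zero_iff.2 h0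
  have := h v hv
  simp [hM] at this

theorem isOpen_accretive : IsOpen {M : Matrix ι ι ℂ | Accretive M} := by
  have key : {M : Matrix ι ι ℂ | Accretive M} =
      {M | ∀ v ∈ Metric.sphere (0 : ι → ℂ) 1, 0 < (star v ⬝ᵥ M *ᵥ v).re} := by
    ext M
    refine ⟨fun h v hv => h v fun h0 => by simp [h0] at hv, fun h v hv => ?_⟩
    have hn : ‖v‖ ≠ 0 := norm_ne_zero_iff.2 hv
    have hn' : 0 < ‖v‖ := norm_pos_iff.2 hv
    have h1 := h (((‖v‖⁻¹ : ℝ) : ℂ) • v) (by simp [norm_smul, hn])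
    rw [star_smul, mulVec_smul, smul_dotProduct, dotProduct_smul] at h1
    simp only [smul_eq_mul, RCLike.star_def, Complex.conj_ofReal, Complex.re_ofReal_mul] at h1
    have h2 : 0 < ‖v‖⁻¹ := inv_pos.2 hn'
    exact pos_of_mul_pos_right (pos_of_mul_pos_right h1 h2.le) h2.le
  rw [key, isOpen_iff_eventually]
  intro M hM
  refine (isCompact_sphere (0 : ι → ℂ) 1).eventually_forall_of_forall_eventually fun v hv => ?_
  refine (IsOpen.mem_nhds ?_ (hM v hv) :
    {p : Matrix ι ι ℂ × (ι → ℂ) | 0 < (star p.2 ⬝ᵥ p.1 *ᵥ p.2).re} ∈ 𝓝 (M, v))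
  refine isOpen_lt continuous_const (Complex.continuous_re.comp ?_)
  exact (continuous_star.comp continuous_snd).dotProduct
    (continuous_fst.matrix_mulVec continuous_snd)

theorem Accretive.add {M N : Matrix ι ι ℂ} (hM : Accretive M) (hN : Accretive N) :
    Accretive (M + N) := fun v hv => by
  rw [add_mulVec, dotProduct_add, Complex.add_re]
  exact add_pos (hM v hv) (hN v hv)

theorem Accretive.smul {M : Matrix ι ι ℂ} (hM : Accretive M) {r : ℝ} (hr : 0 < r) :
    Accretive ((r : ℂ) • M) := fun v hv => by
  rw [smul_mulVec, dotProduct_smul, smul_eq_mul, Complex.re_ofReal_mul]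
  exact mul_pos hr (hM v hv)

theorem Accretive.combo {M N : Matrix ι ι ℂ} (hM : Accretive M) (hN : Accretive N) {s t : ℝ}
    (hs : 0 ≤ s) (ht : 0 ≤ t) (hst : s + t = 1) : Accretive ((s : ℂ) • M + (t : ℂ) • N) := by
  rcases hs.eq_or_lt with rfl | hs
  · obtain rfl : t = 1 := by linarith
    simpa using hN
  rcases ht.eq_or_lt with rfl | ht
  · obtain rfl : s = 1 := by linarith
    simpa using hM
  exact (hM.smul hs).add (hN.smul ht)

theorem Accretive.conj [DecidableEq ι] {M S : Matrix ι ι ℂ} (hM : Accretive M) (hS : IsUnit S) :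
    Accretive (Sᴴ * M * S) := fun v hv => by
  have h := hM (S *ᵥ v) fun h0 => hv ((Matrix.mulVec_injective_iff_isUnit.2 hS)
    (by rw [h0, mulVec_zero]))
  rwa [star_mulVec, ← dotProduct_mulVec, mulVec_mulVec, mulVec_mulVec] at h

theorem accretive_fromBlocks {M : Matrix ι ι ℂ} {N : Matrix κ κ ℂ} (hM : Accretive M)
    (hN : Accretive N) : Accretive (fromBlocks M 0 0 N) := fun v hv => by
  have e : star v ⬝ᵥ fromBlocks M 0 0 N *ᵥ v =
      star (v ∘ Sum.inl) ⬝ᵥ M *ᵥ (v ∘ Sum.inl) + star (v ∘ Sum.inr) ⬝ᵥ N *ᵥ (v ∘ Sum.inr) := by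
    rw [fromBlocks_mulVec]
    simp [dotProduct, Fintype.sum_sum_type]
  rw [e, Complex.add_re]
  by_cases h1 : v ∘ Sum.inl = 0
  · have h2 : v ∘ Sum.inr ≠ 0 := fun h2 => hv <| by
      ext (i | i)
      exacts [congrFun h1 i, congrFun h2 i]
    simpa [h1] using hN _ h2
  · have a1 := hM _ h1
    by_cases h2 : v ∘ Sum.inr = 0
    · simpa [h2] using a1
    · exact add_pos a1 (hN _ h2)

theorem accretive_one [DecidableEq ι] {r : ℂ} (hr : 0 < r.re) :
    Accretive (r • (1 : Matrix ι ι ℂ)) := fun v hv => by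
  have h : star v ⬝ᵥ v = ((∑ i, ‖v i‖ ^ 2 : ℝ) : ℂ) := by
    simp [dotProduct, Complex.conj_mul']
  rw [smul_mulVec, one_mulVec, dotProduct_smul, h, smul_eq_mul, mul_comm, Complex.re_ofReal_mul]
  refine mul_pos ?_ hr
  obtain ⟨i, hi⟩ := Function.ne_iff.1 hv
  exact Finset.sum_pos' (fun _ _ => by positivity) ⟨i, Finset.mem_univ _, by
    have : 0 < ‖v i‖ := norm_pos_iff.2 hi
    positivity⟩

variable [DecidableEq ι] [DecidableEq κ]

theorem isUnit_of_accretive_mul {H c : Matrix ι ι ℂ} (hH : H.IsHermitian) (h : Accretive (H * c))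
    (z : Circle) :
    IsUnit ((1 + (z : ℂ)) • (1 : Matrix ι ι ℂ) + ((z : ℂ) - 1) • c) := by
  rw [Matrix.isUnit_iff_isUnit_det, isUnit_iff_ne_zero]
  intro h0
  obtain ⟨v, hv, hM⟩ := Matrix.exists_mulVec_eq_zero_iff.2 h0
  have hpos := h v hv
  rw [add_mulVec, smul_mulVec, smul_mulVec, one_mulVec] at hM
  have hr : (star v ⬝ᵥ H *ᵥ v).im = 0 := hH.im_star_dotProduct_mulVec_self v
  have e : (1 + (z : ℂ)) * (star v ⬝ᵥ H *ᵥ v) + ((z : ℂ) - 1) * (star v ⬝ᵥ (H * c) *ᵥ v) = 0 := by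
    rw [← mulVec_mulVec, ← smul_eq_mul, ← smul_eq_mul, ← dotProduct_smul, ← dotProduct_smul,
      ← dotProduct_add, ← mulVec_smul, ← mulVec_smul, ← mulVec_add, hM]
    simp
  have hz : (z : ℂ).re * (z : ℂ).re + (z : ℂ).im * (z : ℂ).im = 1 := by
    have := z.normSq_coe
    rwa [Complex.normSq_apply] at this
  generalize star v ⬝ᵥ (H * c) *ᵥ v = X at hpos e
  generalize star v ⬝ᵥ H *ᵥ v = Y at hr e
  have e1 := congrArg Complex.re e
  have e2 := congrArg Complex.im e
  simp only [Complex.add_re, Complex.mul_re, Complex.one_re, Complex.sub_re, Complex.add_im,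
    Complex.mul_im, Complex.one_im, Complex.sub_im, Complex.zero_re, Complex.zero_im, hr] at e1 e2
  set x := (z : ℂ).re
  set y := (z : ℂ).im
  have h3 : ((x - 1) * (x - 1) + y * y) * X.re = 0 := by
    linear_combination (x - 1) * e1 + y * e2 - Y.re * hz
  rcases mul_eq_zero.1 h3 with h4 | h4
  · have hx : x = 1 := by nlinarith [mul_self_nonneg (x - 1), mul_self_nonneg y]
    have hy : y = 0 := by nlinarith [mul_self_nonneg (x - 1), mul_self_nonneg y]
    have hz1 : (z : ℂ) = 1 := Complex.ext hx hy
    rw [hz1] at hM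
    norm_num at hM
    exact hv hM
  · exact hpos.ne' h4

end Lyapunov

section LyapunovExistence

open Matrix

theorem Accretive.submatrix {ι κ : Type*} [Fintype ι] [Fintype κ] {M : Matrix ι ι ℂ}
    (hM : Accretive M) (e : κ ≃ ι) : Accretive (M.submatrix e e) := fun v hv => by
  have h := hM (v ∘ e.symm) fun h0 => hv <| by
    ext i
    simpa using congrFun h0 (e i)
  have e1 : star v ⬝ᵥ M.submatrix e e *ᵥ v = star (v ∘ e.symm) ⬝ᵥ M *ᵥ (v ∘ e.symm) := by
    simp only [dotProduct, mulVec, Matrix.submatrix_apply]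
    refine Fintype.sum_equiv e _ _ fun i => ?_
    simp only [Pi.star_apply, Function.comp_apply, Equiv.symm_apply_apply]
    congr 1
    exact Fintype.sum_equiv e _ _ fun j => by simp
  rwa [e1]

/-- No eigenvalue is purely imaginary. -/
def Hyperbolic {ι : Type*} [Fintype ι] [DecidableEq ι] (c : Matrix ι ι ℂ) : Prop :=
  ∀ μ : ℂ, μ.re = 0 → IsUnit (c - μ • (1 : Matrix ι ι ℂ))

/-- A hermitian matrix `H` is a Lyapunov matrix for `c` if `H * c` is accretive. -/
def HasLyapunov {ι : Type*} [Fintype ι] (c : Matrix ι ι ℂ) : Prop :=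
  ∃ H : Matrix ι ι ℂ, H.IsHermitian ∧ Accretive (H * c)

theorem HasLyapunov.of_submatrix {ι κ : Type*} [Fintype ι] [Fintype κ] {c : Matrix ι ι ℂ}
    (e : κ ≃ ι)
    (h : HasLyapunov (c.submatrix e e)) : HasLyapunov c := by
  obtain ⟨H, hH, hA⟩ := h
  refine ⟨H.submatrix e.symm e.symm, hH.submatrix _, ?_⟩
  convert! hA.submatrix e.symm using 1
  rw [← Matrix.submatrix_mul_equiv _ _ _ e.symm]
  simp

variable {ι κ : Type*} [Fintype ι] [Fintype κ] [DecidableEq ι] [DecidableEq κ]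

theorem HasLyapunov.of_conj {c S : Matrix ι ι ℂ} (hS : IsUnit S) (h : HasLyapunov (S⁻¹ * c * S)) :
    HasLyapunov c := by
  obtain ⟨H, hH, hA⟩ := h
  have hdet := (Matrix.isUnit_iff_isUnit_det S).1 hS
  refine ⟨S⁻¹ᴴ * H * S⁻¹, isHermitian_conjTranspose_mul_mul _ hH, ?_⟩
  convert! hA.conj ((Matrix.isUnit_nonsing_inv_iff).2 hS) using 1
  simp only [mul_assoc, Matrix.mul_nonsing_inv _ hdet, mul_one]

theorem hasLyapunov_fromBlocks {a : ℂ} (ha : a.re ≠ 0) (w : Matrix ι κ ℂ) {d : Matrix κ κ ℂ}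
    (hd : HasLyapunov d) : HasLyapunov (fromBlocks (a • (1 : Matrix ι ι ℂ)) w 0 d) := by
  obtain ⟨H, hH, hA⟩ := hd
  have h1 : Accretive ((((a.re : ℝ) : ℂ) * a) • (1 : Matrix ι ι ℂ)) := accretive_one <| by
    rw [Complex.re_ofReal_mul]
    exact mul_self_pos.2 ha
  have h0 := accretive_fromBlocks h1 hA
  let P : ℂ → Matrix (ι ⊕ κ) (ι ⊕ κ) ℂ := fun s =>
    fromBlocks ((((a.re : ℝ) : ℂ) * a) • 1) (s • ((a.re : ℝ) : ℂ) • w) 0 (H * d)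
  have hP : Continuous P :=
    continuous_const.matrix_fromBlocks (continuous_id.smul continuous_const)
      continuous_const continuous_const
  have hev : ∀ᶠ s in 𝓝 (0 : ℂ), Accretive (P s) :=
    hP.continuousAt.eventually_mem (isOpen_accretive.mem_nhds (by simpa [P] using h0))
  obtain ⟨s, hs, hs0⟩ := ((hev.filter_mono nhdsWithin_le_nhds).and self_mem_nhdsWithin :
    ∀ᶠ s in 𝓝[≠] (0 : ℂ), _ ∧ s ∈ ({0}ᶜ : Set ℂ)).exists
  have hs0 : s ≠ 0 := by exact_mod_cast hs0
  let S : Matrix (ι ⊕ κ) (ι ⊕ κ) ℂ := fromBlocks (s⁻¹ • 1) 0 0 1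
  let T : Matrix (ι ⊕ κ) (ι ⊕ κ) ℂ := fromBlocks (s • 1) 0 0 1
  have hST : S * T = 1 := by simp [S, T, fromBlocks_multiply, smul_smul, hs0]
  have hSi : S⁻¹ = T := Matrix.inv_eq_right_inv hST
  refine HasLyapunov.of_conj (S := S) (.of_mul_eq_one T hST)
    ⟨fromBlocks (((a.re : ℝ) : ℂ) • 1) 0 0 H, ?_, ?_⟩
  · refine IsHermitian.fromBlocks ?_ (by simp) hH
    simp [IsHermitian]
  · convert! hs using 1
    simp only [hSi, S, T, P, fromBlocks_multiply]
    congr 1 <;> simp [smul_smul, hs0, mul_comm a]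
    rw [mul_smul, Complex.coe_smul, smul_comm]

theorem Hyperbolic.conj {c S : Matrix ι ι ℂ} (hS : IsUnit S) (h : Hyperbolic c) :
    Hyperbolic (S⁻¹ * c * S) := fun μ hμ => by
  have hdet := (Matrix.isUnit_iff_isUnit_det S).1 hS
  have e : S⁻¹ * c * S - μ • 1 = S⁻¹ * (c - μ • 1) * S := by
    simp [mul_sub, sub_mul, Matrix.nonsing_inv_mul _ hdet]
  rw [e]
  exact ((Matrix.isUnit_nonsing_inv_iff.2 hS).mul (h μ hμ)).mul hS

theorem hasLyapunov_of_hyperbolic {ι : Type*} [Fintype ι] [DecidableEq ι] {c : Matrix ι ι ℂ}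
    (hc : Hyperbolic c) : HasLyapunov c := by
  induction hn : Fintype.card ι generalizing ι with
  | zero =>
    have := Fintype.card_eq_zero_iff.1 hn
    exact ⟨0, isHermitian_zero, fun v hv => (hv (Subsingleton.elim _ _)).elim⟩
  | succ n ih =>
    have : Nonempty ι := Fintype.card_pos_iff.1 (by omega)
    obtain ⟨a, ha⟩ := Module.End.exists_eigenvalue (Matrix.toLin' c)
    obtain ⟨v, hv⟩ := ha.exists_hasEigenvector
    have hcv : c *ᵥ v = a • v := by simpa using hv.apply_eq_smul
    obtain ⟨i₀, hi₀⟩ := Function.ne_iff.1 hv.2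
    let S : Matrix ι ι ℂ := (1 : Matrix ι ι ℂ).updateCol i₀ v
    have hS : IsUnit S := by
      rw [Matrix.isUnit_iff_isUnit_det, isUnit_iff_ne_zero, ← cramer_apply, cramer_one]
      simpa using hi₀
    have hdet := (Matrix.isUnit_iff_isUnit_det S).1 hS
    have hSe : S *ᵥ Pi.single i₀ 1 = v := by
      ext i
      simp [S]
    have hT : (S⁻¹ * c * S) *ᵥ Pi.single i₀ 1 = a • Pi.single i₀ 1 := by
      rw [← mulVec_mulVec, hSe, ← mulVec_mulVec, hcv, mulVec_smul, ← hSe, mulVec_mulVec,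
        Matrix.nonsing_inv_mul _ hdet, one_mulVec]
    refine HasLyapunov.of_conj hS ?_
    have hh := hc.conj hS
    generalize S⁻¹ * c * S = T at hT hh
    let e := Equiv.sumCompl (fun i => i = i₀)
    have hTi : ∀ i, T i i₀ = if i = i₀ then a else 0 := fun i => by
      have := congrFun hT i
      simpa [Pi.single_apply] using this
    have hTe : T.submatrix e e = fromBlocks (a • (1 : Matrix {i // i = i₀} {i // i = i₀} ℂ))
        (T.submatrix e e).toBlocks₁₂ 0 (T.submatrix e e).toBlocks₂₂ := by
      ext (⟨i, rfl⟩ | ⟨i, hi⟩) (⟨j, hj⟩ | ⟨j, hj⟩)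
      · subst hj
        simp [e, hTi]
      · simp [toBlocks₁₂]
      · subst hj
        simp [e, hTi, hi]
      · simp [toBlocks₂₂]
    refine HasLyapunov.of_submatrix e ?_
    generalize (T.submatrix e e).toBlocks₁₂ = w at hTe
    generalize (T.submatrix e e).toBlocks₂₂ = d at hTe
    have hu : ∀ μ : ℂ, μ.re = 0 →
        IsUnit (a • (1 : Matrix {i // i = i₀} {i // i = i₀} ℂ) - μ • 1) ∧ IsUnit (d - μ • 1) := by
      intro μ hμ
      rw [← Matrix.isUnit_fromBlocks_zero₂₁ (B := w)]
      have h1 := (hh μ hμ).map (Matrix.reindexAlgEquiv ℂ ℂ e.symm)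
      convert! h1 using 1
      have : Matrix.reindexAlgEquiv ℂ ℂ e.symm T = T.submatrix e e := rfl
      rw [map_sub, map_smul, map_one, this, hTe, ← fromBlocks_one, fromBlocks_smul]
      ext (i | i) (j | j) <;> simp
    rw [hTe]
    refine hasLyapunov_fromBlocks (fun ha0 => ?_) w (ih (fun μ hμ => (hu μ hμ).2) ?_)
    · have : Nonempty {i // i = i₀} := ⟨⟨i₀, rfl⟩⟩
      have := (hu a ha0).1
      rw [sub_self] at this
      exact not_isUnit_zero this
    · rw [Fintype.card_subtype_compl, hn]
      simp

end LyapunovExistence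

section Signum

open Matrix
open scoped Matrix.Norms.L2Operator

variable {ι : Type*} [Fintype ι] [DecidableEq ι]

/-- The sign of a hermitian matrix. -/
noncomputable def signum (H : Matrix ι ι ℂ) : Matrix ι ι ℂ := cfc (fun t : ℝ => t * |t|⁻¹) H

theorem continuousOn_mul_inv_abs : ContinuousOn (fun t : ℝ => t * |t|⁻¹) {0}ᶜ :=
  continuousOn_id.mul (continuous_abs.continuousOn.inv₀ fun _ ht => abs_ne_zero.2 ht)

theorem spectrum_subset_compl_zero {H : Matrix ι ι ℂ} (hu : IsUnit H) :
    spectrum ℝ H ⊆ {0}ᶜ := by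
  intro t ht h0
  rw [Set.mem_singleton_iff] at h0
  subst h0
  exact (spectrum.zero_notMem ℝ hu) ht

theorem continuous_signum {X : Type*} [TopologicalSpace X] {H : X → Matrix ι ι ℂ}
    (hH : Continuous H) (hh : ∀ x, (H x).IsHermitian) (hu : ∀ x, IsUnit (H x)) :
    Continuous fun x => signum (H x) := by
  refine Continuous.cfc_of_mem_nhdsSet (s := {0}ᶜ) (fun t : ℝ => t * |t|⁻¹) ?_ hH hh
    continuousOn_mul_inv_abs
  exact isOpen_compl_singleton.mem_nhdsSet.2
    (Set.iUnion_subset fun x => spectrum_subset_compl_zero (hu x))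

theorem isHermitian_signum (H : Matrix ι ι ℂ) : (signum H).IsHermitian :=
  cfc_predicate (R := ℝ) _ H

theorem signum_mul_self {H : Matrix ι ι ℂ} (hh : H.IsHermitian) (hu : IsUnit H) :
    signum H * signum H = 1 := by
  have hc := continuousOn_mul_inv_abs.mono (spectrum_subset_compl_zero hu)
  rw [signum, ← cfc_mul _ _ H hc hc, ← cfc_one ℝ H hh]
  refine cfc_congr fun t ht => ?_
  have : t ≠ 0 := spectrum_subset_compl_zero hu ht
  have : |t| ≠ 0 := abs_ne_zero.2 this
  simp only [Pi.one_apply]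
  field_simp
  simp

theorem accretive_mul_signum {H : Matrix ι ι ℂ} (hh : H.IsHermitian) (hu : IsUnit H) :
    Accretive (H * signum H) := by
  have hc := continuousOn_mul_inv_abs.mono (spectrum_subset_compl_zero hu)
  have hs : IsSelfAdjoint H := hh
  have hr : ContinuousOn (fun t : ℝ => √|t|) (spectrum ℝ H) := by fun_prop
  have e : H * signum H =
      (cfc (fun t : ℝ => √|t|) H)ᴴ * 1 * cfc (fun t : ℝ => √|t|) H := by
    have e1 : (cfc (fun t : ℝ => √|t|) H)ᴴ = cfc (fun t : ℝ => √|t|) H :=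
      cfc_predicate (R := ℝ) (fun t : ℝ => √|t|) H
    rw [e1, mul_one, ← cfc_mul _ _ H hr hr, signum]
    conv_lhs => enter [1]; rw [← cfc_id' ℝ H]
    rw [← cfc_mul _ _ H (by fun_prop) hc]
    refine cfc_congr fun t ht => ?_
    have : t ≠ 0 := spectrum_subset_compl_zero hu ht
    have : |t| ≠ 0 := abs_ne_zero.2 this
    simp only [Real.mul_self_sqrt (abs_nonneg t)]
    field_simp
    simp
  rw [e]
  refine Accretive.conj ?_ ?_
  · simpa using accretive_one (ι := ι) (r := 1) (by simp)
  · rw [isUnit_cfc_iff _ _ hr]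
    intro t ht
    have : t ≠ 0 := spectrum_subset_compl_zero hu ht
    positivity

end Signum

section Involution

open Matrix

/-- Families of loops defined by a family of hermitian involutions are good. -/
def InvolutionGood {X : Type*} [TopologicalSpace X] (x₀ : X) (A : Set X) : Prop :=
  ∀ (ι : Type) [Fintype ι] [DecidableEq ι] (s : X → Matrix ι ι ℂ)
    (hF : Continuous fun p : X × Circle =>
      (1 + (p.2 : ℂ)) • (1 : Matrix ι ι ℂ) + ((p.2 : ℂ) - 1) • s p.1)
    (hu : ∀ p : X × Circle,
      IsUnit ((1 + (p.2 : ℂ)) • (1 : Matrix ι ι ℂ) + ((p.2 : ℂ) - 1) • s p.1)),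
    Continuous s → (∀ x, (s x).IsHermitian) → (∀ x, s x * s x = 1) → (∀ x ∈ A, s x = s x₀) →
    Good x₀ A (unitsMk _ hF hu)

variable {ι : Type*} [Fintype ι] [DecidableEq ι]

theorem hyperbolic_of_isUnit {c : Matrix ι ι ℂ}
    (h : ∀ z : Circle, IsUnit ((1 + (z : ℂ)) • (1 : Matrix ι ι ℂ) + ((z : ℂ) - 1) • c)) :
    Hyperbolic c := by
  intro μ hμ
  have hμ1 : μ + 1 ≠ 0 := fun h0 => by
    have := congrArg Complex.re h0
    simp [hμ] at this
  have hw : Complex.I * (μ + 1) ≠ 0 := mul_ne_zero Complex.I_ne_zero hμ1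
  have hconj : (starRingEnd ℂ) μ = -μ := by
    apply Complex.ext <;> simp [hμ]
  have hz : (Circle.ofConjDivSelf _ hw : ℂ) = (μ - 1) / (μ + 1) := by
    simp only [Circle.ofConjDivSelf, map_mul, Complex.conj_I, map_add, hconj, map_one]
    field_simp
    ring
  have h1 := h (Circle.ofConjDivSelf _ hw)
  rw [hz] at h1
  have e : (1 + (μ - 1) / (μ + 1)) • (1 : Matrix ι ι ℂ) + ((μ - 1) / (μ + 1) - 1) • c =
      (-2 / (μ + 1)) • (c - μ • 1) := by
    have e1 : 1 + (μ - 1) / (μ + 1) = -(-2 / (μ + 1) * μ) := by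
      field_simp
      ring
    have e2 : (μ - 1) / (μ + 1) - 1 = -2 / (μ + 1) := by
      field_simp
      ring
    rw [e1, e2, smul_sub, smul_smul, neg_smul]
    abel
  rw [e] at h1
  have h2 := h1.smul (Units.mk0 (-2 / (μ + 1)) (by simp [hμ1]))⁻¹
  rwa [Units.smul_def, smul_smul, Units.val_inv_eq_inv_val, Units.val_mk0,
    inv_mul_cancel₀ (by simp [hμ1]), one_smul] at h2

theorem exists_continuous_lyapunov {X : Type*} [TopologicalSpace X] [NormalSpace X]
    [ParacompactSpace X] {A : Set X} (hA : IsClosed A) {x₀ : X} (hx₀ : x₀ ∈ A)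
    {c : X → Matrix ι ι ℂ} (hc : Continuous c) (hcA : ∀ x ∈ A, c x = c x₀)
    (hh : ∀ x, Hyperbolic (c x)) :
    ∃ H : X → Matrix ι ι ℂ, Continuous H ∧ (∀ x, (H x).IsHermitian) ∧
      (∀ x, Accretive (H x * c x)) ∧ ∀ x ∈ A, H x = H x₀ := by
  obtain ⟨H₀, hH₀, hacc₀⟩ := hasLyapunov_of_hyperbolic (hh x₀)
  have hev : ∀ (H : Matrix ι ι ℂ) x, Accretive (H * c x) → ∀ᶠ y in 𝓝 x, Accretive (H * c y) :=
    fun H x hx => (continuous_const.mul hc).continuousAt.eventually_mem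
      (isOpen_accretive.mem_nhds hx)
  obtain ⟨g, hg⟩ := exists_continuous_forall_mem_convex_of_local_const
    (t := fun x => {H : Matrix ι ι ℂ | H.IsHermitian ∧ Accretive (H * c x) ∧ (x ∈ A → H = H₀)})
    (fun x H ⟨h1, h2, h3⟩ H' ⟨h1', h2', h3'⟩ s t hs ht hst => by
      refine ⟨?_, ?_, fun hx => ?_⟩
      · exact (h1.smul (k := s) rfl).add (h1'.smul (k := t) rfl)
      · rw [add_mul, smul_mul_assoc, smul_mul_assoc]
        exact h2.combo h2' hs ht hst
      · rw [h3 hx, h3' hx, ← add_smul, hst, one_smul])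
    (fun x => by
      by_cases hx : x ∈ A
      · refine ⟨H₀, ?_⟩
        filter_upwards [hev H₀ x (by rwa [hcA x hx])] with y hy
        exact ⟨hH₀, hy, fun _ => rfl⟩
      · obtain ⟨H, hH, hacc⟩ := hasLyapunov_of_hyperbolic (hh x)
        refine ⟨H, ?_⟩
        filter_upwards [hev H x hacc, hA.isOpen_compl.mem_nhds hx] with y hy hyA
        exact ⟨hH, hy, fun h => (hyA h).elim⟩)
  exact ⟨g, g.continuous, fun x => (hg x).1, fun x => (hg x).2.1, fun x hx => by
    rw [(hg x).2.2 hx, (hg x₀).2.2 hx₀]⟩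

theorem linearGood_of_involutionGood {X : Type*} [TopologicalSpace X] [NormalSpace X]
    [ParacompactSpace X] {A : Set X} (hA : IsClosed A) {x₀ : X} (hx₀ : x₀ ∈ A)
    (h : InvolutionGood x₀ A) : LinearGood x₀ A := by
  intro ι _ _ a b hF hu ha hb haA hbA
  have hU : ∀ x, IsUnit ((2⁻¹ : ℂ) • (a x + b x)) := fun x => by
    have := hu (x, 1)
    simp only [Circle.coe_one, one_smul] at this
    exact this.smul (Units.mk0 (2⁻¹ : ℂ) (by norm_num))
  let U : C(X, (Matrix ι ι ℂ)ˣ) := unitsMk (fun x => (2⁻¹ : ℂ) • (a x + b x))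
    ((ha.add hb).const_smul (2⁻¹ : ℂ)) hU
  let c : X → Matrix ι ι ℂ := fun x => ((U x)⁻¹ : (Matrix ι ι ℂ)ˣ) * ((2⁻¹ : ℂ) • (b x - a x))
  have hc : Continuous c :=
    (Units.continuous_val.comp U.continuous.inv).mul ((hb.sub ha).const_smul (2⁻¹ : ℂ))
  have hUc : ∀ x, (U x : Matrix ι ι ℂ) * c x = (2⁻¹ : ℂ) • (b x - a x) := fun x => by
    simp [c]
  have hUF : ∀ p : X × Circle, (U p.1 : Matrix ι ι ℂ) *
      ((1 + (p.2 : ℂ)) • (1 : Matrix ι ι ℂ) + ((p.2 : ℂ) - 1) • c p.1) =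
      a p.1 + (p.2 : ℂ) • b p.1 := fun p => by
    rw [mul_add, mul_smul_comm, mul_smul_comm, hUc, mul_one]
    simp only [U, unitsMk_apply]
    module
  have hcu : ∀ p : X × Circle,
      IsUnit ((1 + (p.2 : ℂ)) • (1 : Matrix ι ι ℂ) + ((p.2 : ℂ) - 1) • c p.1) := fun p => by
    have := hu p
    rw [← hUF, Units.isUnit_units_mul] at this
    exact this
  have hcA : ∀ x ∈ A, c x = c x₀ := fun x hx => by
    have : U x = U x₀ := Units.ext (by simp [U, haA x hx, hbA x hx])
    simp only [c, this, haA x hx, hbA x hx]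
  have hz : Continuous fun p : X × Circle => (p.2 : ℂ) := by fun_prop
  have hcF : Continuous fun p : X × Circle =>
      (1 + (p.2 : ℂ)) • (1 : Matrix ι ι ℂ) + ((p.2 : ℂ) - 1) • c p.1 :=
    ((continuous_const.add hz).smul continuous_const).add
      ((hz.sub continuous_const).smul (hc.comp continuous_fst))
  refine Good.of_mul (F' := unitsMk _ hcF hcu) (fun x => (U x)⁻¹) 1 rfl (fun p => ?_) ?_
  · rw [Pi.one_apply, mul_one, eq_inv_mul_iff_mul_eq]
    exact Units.ext (hUF p)
  obtain ⟨H, hHc, hHh, hHacc, hHA⟩ := exists_continuous_lyapunov hA hx₀ hc hcA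
    (fun x => hyperbolic_of_isUnit fun z => hcu (x, z))
  have hHu : ∀ x, IsUnit (H x) := fun x => isUnit_of_mul_isUnit_left (hHacc x).isUnit
  have hsacc := fun x => accretive_mul_signum (hHh x) (hHu x)
  have hsc := continuous_signum hHc hHh hHu
  have hsF : Continuous fun p : X × Circle =>
      (1 + (p.2 : ℂ)) • (1 : Matrix ι ι ℂ) + ((p.2 : ℂ) - 1) • signum (H p.1) :=
    ((continuous_const.add hz).smul continuous_const).add
      ((hz.sub continuous_const).smul (hsc.comp continuous_fst))
  have good := h ι (fun x => signum (H x)) hsF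
    (fun p => isUnit_of_accretive_mul (hHh p.1) (hsacc p.1) p.2) hsc
    (fun x => isHermitian_signum _) (fun x => signum_mul_self (hHh x) (hHu x))
    (fun x hx => by rw [hHA x hx])
  refine good.of_homotopy (fun p => (1 + (p.2.2 : ℂ)) • (1 : Matrix ι ι ℂ) +
    ((p.2.2 : ℂ) - 1) • (((1 - (p.1 : ℝ) : ℝ) : ℂ) • c p.2.1 +
      ((p.1 : ℝ) : ℂ) • signum (H p.2.1))) ?_ ?_ ?_ ?_ ?_
  · have hz' : Continuous fun p : I × X × Circle => (p.2.2 : ℂ) := by fun_prop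
    have hc' : Continuous fun p : I × X × Circle => c p.2.1 := hc.comp (by fun_prop)
    have hs' : Continuous fun p : I × X × Circle => signum (H p.2.1) := hsc.comp (by fun_prop)
    have ht : Continuous fun p : I × X × Circle => ((p.1 : ℝ) : ℂ) := by fun_prop
    have ht' : Continuous fun p : I × X × Circle => ((1 - (p.1 : ℝ) : ℝ) : ℂ) := by fun_prop
    exact ((continuous_const.add hz').smul continuous_const).add
      ((hz'.sub continuous_const).smul ((ht'.smul hc').add (ht.smul hs')))
  · intro p
    refine isUnit_of_accretive_mul (hHh p.2.1) ?_ p.2.2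
    rw [mul_add, mul_smul_comm, mul_smul_comm]
    exact (hHacc _).combo (hsacc _) (by linarith [p.1.2.2]) p.1.2.1 (by ring)
  · intro p
    simp
  · intro p
    simp
  · intro t x hx z
    simp only [hcA x hx, hHA x hx]

end Involution

section Whitehead

open Matrix

variable {X : Type*} [TopologicalSpace X]
variable {ι : Type} [Fintype ι] [DecidableEq ι]

theorem stablyNull_one (S : Set X) : StablyNull S (1 : C(X, (Matrix ι ι ℂ)ˣ)) :=
  ⟨Empty, inferInstance, inferInstance, by
    convert! ContinuousMap.HomotopicRel.refl (S := S)
      (1 : C(X, (Matrix (ι ⊕ Empty) (ι ⊕ Empty) ℂ)ˣ))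
      using 1
    ext1 x
    simp⟩

theorem good_of_const {x₀ : X} {A : Set X} {F : C(X × Circle, (Matrix ι ι ℂ)ˣ)}
    (hF : ∀ p, F p = F (x₀, p.2)) : Good x₀ A F := by
  have : nrm x₀ F = 1 := by
    ext1 p
    rw [nrm_apply, hF p, hF (p.1, 1)]
    simp
  rw [Good, this]
  exact stablyNull_one _

/-- The path from `1` to `g ⊕ g⁻¹` given by Whitehead's lemma. -/
def whitehead (t : ℂ) (g : (Matrix ι ι ℂ)ˣ) : Matrix (ι ⊕ ι) (ι ⊕ ι) ℂ :=
  fromBlocks 1 (t • (g : Matrix ι ι ℂ)) 0 1 *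
    fromBlocks 1 0 (-(t • ((g⁻¹ : (Matrix ι ι ℂ)ˣ) : Matrix ι ι ℂ))) 1 *
    fromBlocks 1 (t • (g : Matrix ι ι ℂ)) 0 1 *
    (fromBlocks 1 (-(t • (1 : Matrix ι ι ℂ))) 0 1 * fromBlocks 1 0 (t • (1 : Matrix ι ι ℂ)) 1 *
      fromBlocks 1 (-(t • (1 : Matrix ι ι ℂ))) 0 1)

theorem isUnit_whitehead (t : ℂ) (g : (Matrix ι ι ℂ)ˣ) : IsUnit (whitehead t g) :=
  (((isUnit_fromBlocks_upper _).mul (isUnit_fromBlocks_lower _)).mul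
    (isUnit_fromBlocks_upper _)).mul
    (((isUnit_fromBlocks_upper _).mul (isUnit_fromBlocks_lower _)).mul (isUnit_fromBlocks_upper _))

theorem whitehead_zero (g : (Matrix ι ι ℂ)ˣ) : whitehead 0 g = 1 := by
  simp [whitehead]

theorem whitehead_one_left (g : (Matrix ι ι ℂ)ˣ) :
    whitehead 1 g = fromBlocks (g : Matrix ι ι ℂ) 0 0 (g⁻¹ : (Matrix ι ι ℂ)ˣ) := by
  simp only [whitehead, fromBlocks_multiply]
  simp

theorem whitehead_one_right (t : ℂ) : whitehead t (1 : (Matrix ι ι ℂ)ˣ) = 1 := by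
  simp only [whitehead, fromBlocks_multiply, ← fromBlocks_one]
  congr 1 <;> simp [mul_add, smul_smul] <;> module

theorem continuous_whitehead :
    Continuous fun p : ℂ × (Matrix ι ι ℂ)ˣ => whitehead p.1 p.2 := by
  have h1 : Continuous fun p : ℂ × (Matrix ι ι ℂ)ˣ => p.1 • (p.2 : Matrix ι ι ℂ) :=
    continuous_fst.smul (Units.continuous_val.comp continuous_snd)
  have h2 : Continuous fun p : ℂ × (Matrix ι ι ℂ)ˣ =>
      -(p.1 • ((p.2⁻¹ : (Matrix ι ι ℂ)ˣ) : Matrix ι ι ℂ)) :=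
    (continuous_fst.smul (Units.continuous_val.comp continuous_snd.inv)).neg
  have h3 : Continuous fun p : ℂ × (Matrix ι ι ℂ)ˣ => p.1 • (1 : Matrix ι ι ℂ) :=
    continuous_fst.smul continuous_const
  have c0 : Continuous fun _ : ℂ × (Matrix ι ι ℂ)ˣ => (0 : Matrix ι ι ℂ) := continuous_const
  have c1 : Continuous fun _ : ℂ × (Matrix ι ι ℂ)ˣ => (1 : Matrix ι ι ℂ) := continuous_const
  exact (((c1.matrix_fromBlocks h1 c0 c1).mul (c1.matrix_fromBlocks c0 h2 c1)).mul
    (c1.matrix_fromBlocks h1 c0 c1)).mul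
    (((c1.matrix_fromBlocks h3.neg c0 c1).mul (c1.matrix_fromBlocks c0 h3 c1)).mul
    (c1.matrix_fromBlocks h3.neg c0 c1))

theorem good_conj {x₀ : X} {A : Set X} (hx₀ : x₀ ∈ A) {F : C(X × Circle, (Matrix ι ι ℂ)ˣ)}
    (g : C(X, (Matrix ι ι ℂ)ˣ)) (hg : ∀ x ∈ A, g x = 1) (D : C(Circle, (Matrix ι ι ℂ)ˣ))
    (hF : ∀ p, F p = g p.1 * D p.2 * (g p.1)⁻¹) : Good x₀ A F := by
  obtain ⟨W, hW⟩ : ∃ W : C(I × X × Circle, (Matrix (ι ⊕ ι) (ι ⊕ ι) ℂ)ˣ),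
      ∀ p, (W p : Matrix (ι ⊕ ι) (ι ⊕ ι) ℂ) = whitehead (((1 - (p.1 : ℝ) : ℝ) : ℂ)) (g p.2.1) :=
    ⟨unitsMk (fun p => whitehead (((1 - (p.1 : ℝ) : ℝ) : ℂ)) (g p.2.1))
      (continuous_whitehead.comp (f := fun p : I × X × Circle =>
        (((1 - (p.1 : ℝ) : ℝ) : ℂ), g p.2.1)) (by fun_prop)) fun p => isUnit_whitehead _ _,
      fun p => rfl⟩
  have hW0 : ∀ p, W (0, p) = stab ι ι (g p.1) * reindexHom (Equiv.sumComm ι ι)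
      (stab ι ι (g p.1)⁻¹) := fun p => Units.ext (by
    rw [hW, show ((1 - ((0 : I) : ℝ) : ℝ) : ℂ) = 1 by simp, whitehead_one_left, Units.val_mul,
      stab_apply, reindexHom_apply, stab_apply]
    simp [fromBlocks_multiply])
  have hW1 : ∀ p, W (1, p) = 1 := fun p => Units.ext (by
    rw [hW, show ((1 - ((1 : I) : ℝ) : ℝ) : ℂ) = 0 by simp, whitehead_zero, Units.val_one])
  have hWA : ∀ t, ∀ x ∈ A, ∀ z, W (t, x, z) = 1 := fun t x hx z => Units.ext (by
    rw [hW, hg x hx, whitehead_one_right, Units.val_one])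
  let G : C(X × Circle, (Matrix (ι ⊕ ι) (ι ⊕ ι) ℂ)ˣ) :=
    ⟨fun p => stab ι ι (D p.2), by fun_prop⟩
  refine Good.of_stab (κ := ι) ((good_of_const (F := G) fun p => rfl).of_homotopy
    (fun p => (W p * stab ι ι (D p.2.2) * (W p)⁻¹ : (Matrix (ι ⊕ ι) (ι ⊕ ι) ℂ)ˣ))
    ?_ (fun p => Units.isUnit _) ?_ ?_ ?_)
  · refine Units.continuous_val.comp ((W.continuous.mul ?_).mul W.continuous.inv)
    exact (stab ι ι).continuous_toFun.comp (D.continuous.comp (by fun_prop))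
  · intro p
    have hcomm : ∀ a b : (Matrix ι ι ℂ)ˣ, Commute (reindexHom (Equiv.sumComm ι ι) (stab ι ι a))
        (stab ι ι b) := fun a b => Units.ext (by simp [fromBlocks_multiply])
    have h1 := (hcomm (g p.1)⁻¹ (D p.2)).eq
    have h2 : ((stab ι ι).toContinuousMap.comp F) p =
        stab ι ι (g p.1) * stab ι ι (D p.2) * (stab ι ι (g p.1))⁻¹ := by
      rw [← map_inv, ← map_mul, ← map_mul, ← hF]
      rfl
    rw [hW0, h2]
    generalize stab ι ι (g p.1) = a
    generalize reindexHom (Equiv.sumComm ι ι) (stab ι ι (g p.1)⁻¹) = b at h1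
    generalize stab ι ι (D p.2) = d at h1
    rw [mul_assoc a b, h1, _root_.mul_inv_rev, mul_assoc, mul_assoc, mul_inv_cancel_left, mul_assoc]
  · intro p
    rw [hW1, inv_one, one_mul, mul_one]
    rfl
  · intro t x hx z
    rw [hWA t x hx z, hWA t x₀ hx₀ z]

end Whitehead

section PathLifting

open Matrix

variable {Y : Type*} [TopologicalSpace Y] {ι : Type} [Fintype ι] [DecidableEq ι]

theorem isOpen_isUnit : IsOpen {M : Matrix ι ι ℂ | IsUnit M} := by
  have : {M : Matrix ι ι ℂ | IsUnit M} = {M | M.det ≠ 0} := by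
    ext M
    simp [Matrix.isUnit_iff_isUnit_det]
  rw [this]
  exact isOpen_ne_fun continuous_id.matrix_det continuous_const

/-- An intertwiner between two involutions `s` and `s'`, invertible if they are close. -/
noncomputable def intertwiner (s' s : Matrix ι ι ℂ) : Matrix ι ι ℂ := (2⁻¹ : ℂ) • (1 + s' * s)

theorem intertwiner_self {s : Matrix ι ι ℂ} (hs : s * s = 1) : intertwiner s s = 1 := by
  rw [intertwiner, hs, ← two_smul ℂ (1 : Matrix ι ι ℂ), smul_smul]
  norm_num

theorem intertwiner_mul {s s' : Matrix ι ι ℂ} (hs : s * s = 1) (hs' : s' * s' = 1) :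
    intertwiner s' s * s = s' * intertwiner s' s := by
  simp only [intertwiner, smul_mul_assoc, mul_smul_comm, add_mul, mul_add, one_mul, mul_one]
  rw [mul_assoc, hs, mul_one, ← mul_assoc, hs', one_mul, add_comm]

/-- Homotopies of involutions are given by conjugation. -/
theorem exists_conj_eq [CompactSpace Y] {B : Set Y} {s : Y × I → Matrix ι ι ℂ} (hs : Continuous s)
    (hs2 : ∀ x, s x * s x = 1) (hB : ∀ y ∈ B, ∀ t, s (y, t) = s (y, 0)) :
    ∃ g : C(Y × I, (Matrix ι ι ℂ)ˣ), (∀ y, g (y, 0) = 1) ∧ (∀ y ∈ B, ∀ t, g (y, t) = 1) ∧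
      ∀ y t, s (y, t) * g (y, t) = g (y, t) * s (y, 0) := by
  have hW : {p : I × I | ∀ y, IsUnit (intertwiner (s (y, p.1)) (s (y, p.2)))} ∈
      uniformity I := by
    rw [← nhdsSet_diagonal_eq_uniformity]
    refine mem_nhdsSet_iff_forall.2 ?_
    rintro ⟨t, t'⟩ (rfl : t = t')
    have := isCompact_univ.eventually_forall_of_forall_eventually (x₀ := (t, t)) (K := Set.univ)
      (P := fun (p : I × I) (y : Y) => IsUnit (intertwiner (s (y, p.1)) (s (y, p.2))))
      fun y _ => by
        refine (IsOpen.mem_nhds (isOpen_isUnit.preimage (f := fun q : (I × I) × Y =>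
          intertwiner (s (q.2, q.1.1)) (s (q.2, q.1.2))) ?_) ?_)
        · refine (continuous_const.add (Continuous.mul (hs.comp ?_) (hs.comp ?_))).const_smul
            (2⁻¹ : ℂ) <;> fun_prop
        · simp [intertwiner_self (hs2 _)]
    simp only [Set.mem_univ, true_implies] at this
    exact this
  obtain ⟨ε, hε, hW⟩ := Metric.mem_uniformity_dist.1 hW
  obtain ⟨N, hN⟩ := exists_nat_one_div_lt hε
  have key : ∀ k : ℕ, ∃ g : C(Y × I, (Matrix ι ι ℂ)ˣ), (∀ y, g (y, 0) = 1) ∧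
      (∀ y ∈ B, ∀ t, g (y, t) = 1) ∧
      ∀ y t, s (y, min t (Set.projIcc 0 1 zero_le_one (k / (N + 1)))) * g (y, t) =
        g (y, t) * s (y, 0) := by
    intro k
    induction k with
    | zero =>
      refine ⟨1, fun _ => rfl, fun _ _ _ => rfl, fun y t => ?_⟩
      have : Set.projIcc (0 : ℝ) 1 zero_le_one ((0 : ℕ) / (N + 1)) = 0 :=
        Set.projIcc_of_le_left _ (by simp)
      rw [this, min_eq_right (show (0 : I) ≤ t from t.2.1)]
      simp
    | succ k ih =>
      obtain ⟨g, hg0, hgB, hg⟩ := ih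
      set a := Set.projIcc (0 : ℝ) 1 zero_le_one (k / (N + 1))
      set b := Set.projIcc (0 : ℝ) 1 zero_le_one ((k + 1 : ℕ) / (N + 1))
      have hab : dist b a < ε := by
        refine lt_of_le_of_lt ?_ hN
        have h1 : dist b a ≤ dist (((k + 1 : ℕ) : ℝ) / (N + 1)) (k / (N + 1)) :=
          Set.abs_projIcc_sub_projIcc _
        refine h1.trans_eq ?_
        rw [Real.dist_eq, ← sub_div, Nat.cast_add_one, add_sub_cancel_left,
          abs_of_pos (by positivity)]
      have hu : ∀ p : Y × I, IsUnit (intertwiner (s (p.1, min p.2 b)) (s (p.1, min p.2 a))) := by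
        intro p
        refine hW (lt_of_le_of_lt ?_ hab) p.1
        rw [Subtype.dist_eq, Subtype.dist_eq, Real.dist_eq, Real.dist_eq]
        exact (abs_min_sub_min_le_max _ _ _ _).trans (by simp)
      have hc : Continuous fun p : Y × I =>
          intertwiner (s (p.1, min p.2 b)) (s (p.1, min p.2 a)) := by
        refine (continuous_const.add (Continuous.mul (hs.comp ?_) (hs.comp ?_))).const_smul
            (2⁻¹ : ℂ) <;> fun_prop
      refine ⟨unitsMk _ hc hu * g, fun y => Units.ext ?_, fun y hy t => Units.ext ?_,
        fun y t => ?_⟩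
      · simp [hg0, intertwiner_self (hs2 _)]
      · rw [ContinuousMap.mul_apply, hgB y hy, mul_one, unitsMk_apply, hB y hy (min t b),
          hB y hy (min t a), intertwiner_self (hs2 _), Units.val_one]
      · rw [ContinuousMap.mul_apply, Units.val_mul, unitsMk_apply, ← mul_assoc,
          ← intertwiner_mul (hs2 _) (hs2 _), mul_assoc, hg, mul_assoc]
  obtain ⟨g, hg0, hgB, hg⟩ := key (N + 1)
  refine ⟨g, hg0, hgB, fun y t => ?_⟩
  have h1 : Set.projIcc (0 : ℝ) 1 zero_le_one ((N + 1 : ℕ) / (N + 1)) = 1 :=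
    Set.projIcc_of_right_le _ (by
      rw [Nat.cast_add_one, div_self (by positivity)])
  have := hg y t
  rwa [h1, min_eq_left (show t ≤ 1 from t.2.2)] at this

end PathLifting

section BottPeriodicity

open Matrix

variable {Y : Type*} [TopologicalSpace Y]

/-- The subspace `B × I ∪ Y × {0, 1}`. -/
def cylinder (B : Set Y) : Set (Y × I) := {x | x.1 ∈ B ∨ x.2 = 0 ∨ x.2 = 1}

variable {p q κ₁ κ₂ : Type} [Fintype p] [DecidableEq p] [Fintype q] [DecidableEq q]
  [Fintype κ₁] [DecidableEq κ₁] [Fintype κ₂] [DecidableEq κ₂]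

/-- Block diagonal invertible matrices. -/
def blockDiag : (Matrix p p ℂ)ˣ × (Matrix q q ℂ)ˣ →ₜ* (Matrix (p ⊕ q) (p ⊕ q) ℂ)ˣ where
  toFun A :=
    ⟨fromBlocks A.1 0 0 A.2, fromBlocks (A.1⁻¹ : (Matrix p p ℂ)ˣ) 0 0 (A.2⁻¹ : (Matrix q q ℂ)ˣ),
      by simp [fromBlocks_multiply], by simp [fromBlocks_multiply]⟩
  map_one' := Units.ext (by simp)
  map_mul' A B := Units.ext (by simp [fromBlocks_multiply])
  continuous_toFun := continuous_of_val <|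
    (Units.continuous_val.comp continuous_fst).matrix_fromBlocks continuous_const continuous_const
      (Units.continuous_val.comp continuous_snd)

@[simp]
theorem blockDiag_apply (A : (Matrix p p ℂ)ˣ × (Matrix q q ℂ)ˣ) :
    (blockDiag A : Matrix (p ⊕ q) (p ⊕ q) ℂ) = fromBlocks A.1 0 0 A.2 := rfl

/-- A scalar matrix. -/
def scalarUnit (ι : Type) [Fintype ι] [DecidableEq ι] (z : ℂˣ) : (Matrix ι ι ℂ)ˣ :=
  Units.map (algebraMap ℂ (Matrix ι ι ℂ)).toMonoidHom z

theorem scalarUnit_apply {ι : Type} [Fintype ι] [DecidableEq ι] (z : ℂˣ) :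
    (scalarUnit ι z : Matrix ι ι ℂ) = (z : ℂ) • (1 : Matrix ι ι ℂ) :=
  Algebra.algebraMap_eq_smul_one _

theorem continuous_scalarUnit_comp {X : Type*} [TopologicalSpace X] {ι : Type} [Fintype ι]
    [DecidableEq ι] {z : X → ℂˣ} (hz : Continuous fun x => (z x : ℂ)) :
    Continuous fun x => scalarUnit ι (z x) :=
  continuous_of_val (by
    simp only [scalarUnit_apply]
    exact hz.smul continuous_const)

theorem blockDiag_scalarUnit (z : ℂˣ) :
    blockDiag (scalarUnit p z, scalarUnit q z) = scalarUnit (p ⊕ q) z :=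
  Units.ext (by simp [scalarUnit_apply, fromBlocks_smul, ← fromBlocks_one])

theorem exists_eq_blockDiag {X : Type*} [TopologicalSpace X]
    (h : C(X, (Matrix (p ⊕ q) (p ⊕ q) ℂ)ˣ))
    (hh : ∀ x, fromBlocks 1 0 0 (-1) * (h x : Matrix (p ⊕ q) (p ⊕ q) ℂ) =
      (h x : Matrix (p ⊕ q) (p ⊕ q) ℂ) * fromBlocks 1 0 0 (-1)) :
    ∃ (h₁ : C(X, (Matrix p p ℂ)ˣ)) (h₂ : C(X, (Matrix q q ℂ)ˣ)), ∀ x,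
      h x = blockDiag (h₁ x, h₂ x) := by
  have hblock : ∀ x, (h x : Matrix (p ⊕ q) (p ⊕ q) ℂ) =
      fromBlocks (h x).1.toBlocks₁₁ 0 0 (h x).1.toBlocks₂₂ := by
    intro x
    have := hh x
    generalize (h x : Matrix (p ⊕ q) (p ⊕ q) ℂ) = M at this ⊢
    rw [← fromBlocks_toBlocks M] at this
    simp only [fromBlocks_multiply] at this
    have e12 : M.toBlocks₁₂ = 0 := by
      have := (fromBlocks_inj.1 this).2.1
      ext i j
      simpa [self_eq_neg] using congrFun (congrFun this i) j
    have e21 : M.toBlocks₂₁ = 0 := by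
      have := (fromBlocks_inj.1 this).2.2.1
      ext i j
      simpa [neg_eq_self] using congrFun (congrFun this i) j
    conv_lhs => rw [← fromBlocks_toBlocks M, e12, e21]
  have hu : ∀ x, IsUnit (h x).1.toBlocks₁₁ ∧ IsUnit (h x).1.toBlocks₂₂ := fun x => by
    rw [← isUnit_fromBlocks_zero₁₂ (C := 0), ← hblock]
    exact (h x).isUnit
  have hc : Continuous fun x => (h x : Matrix (p ⊕ q) (p ⊕ q) ℂ) :=
    Units.continuous_val.comp h.continuous
  refine ⟨unitsMk (fun x => (h x).1.toBlocks₁₁) (hc.matrix_submatrix _ _) fun x => (hu x).1,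
    unitsMk (fun x => (h x).1.toBlocks₂₂) (hc.matrix_submatrix _ _) fun x => (hu x).2, fun x => ?_⟩
  exact Units.ext (hblock x)

/-- The loop in the block form of an involution. -/
theorem good_of_involution_fromBlocks [CompactSpace Y] {B : Set Y} (hY : AllStablyNull Y B) (y₀ : Y)
    (s : Y × I → Matrix (p ⊕ q) (p ⊕ q) ℂ) (hs : Continuous s) (hs2 : ∀ x, s x * s x = 1)
    (hsA : ∀ x ∈ cylinder B, s x = fromBlocks 1 0 0 (-1))
    (F : C((Y × I) × Circle, (Matrix (p ⊕ q) (p ⊕ q) ℂ)ˣ))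
    (hF : ∀ x, (F x : Matrix (p ⊕ q) (p ⊕ q) ℂ) =
      (1 + (x.2 : ℂ)) • (1 : Matrix (p ⊕ q) (p ⊕ q) ℂ) + ((x.2 : ℂ) - 1) • s x.1) :
    Good (y₀, 0) (cylinder B) F := by
  have hs0 : ∀ y, s (y, 0) = fromBlocks 1 0 0 (-1) := fun y => hsA _ (Or.inr (Or.inl rfl))
  obtain ⟨g, hg0, hgB, hg⟩ := exists_conj_eq hs hs2 (B := B) fun y hy t => by
    rw [hsA _ (Or.inl hy), hs0]
  obtain ⟨h₁, h₂, hh⟩ := exists_eq_blockDiag (g.comp ⟨fun y => (y, 1), by fun_prop⟩) (fun y => by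
    have := hg y 1
    rwa [hsA _ (Or.inr (Or.inr rfl)), hs0] at this)
  have hh : ∀ y, g (y, 1) = blockDiag (h₁ y, h₂ y) := hh
  have hB1 : ∀ y ∈ B, h₁ y = 1 ∧ h₂ y = 1 := fun y hy => by
    have := congrArg Units.val ((hh y).symm.trans (hgB y hy 1))
    rw [blockDiag_apply, Units.val_one, ← fromBlocks_one, fromBlocks_inj] at this
    exact ⟨Units.ext this.1, Units.ext this.2.2.2⟩
  obtain ⟨κ₁, _, _, ⟨K₁⟩⟩ := hY p h₁ fun y hy => (hB1 y hy).1
  obtain ⟨κ₂, _, _, ⟨K₂⟩⟩ := hY q h₂ fun y hy => (hB1 y hy).2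
  let e := Equiv.sumSumSumComm p q κ₁ κ₂
  let d : Circle → ℂˣ := fun z => Units.mk0 2 two_ne_zero * z.toUnits
  let D : C(Circle, (Matrix ((p ⊕ κ₁) ⊕ (q ⊕ κ₂)) ((p ⊕ κ₁) ⊕ (q ⊕ κ₂)) ℂ)ˣ) :=
    ⟨fun z => blockDiag (scalarUnit _ (d z), scalarUnit _ (d 1)), by
      refine blockDiag.continuous_toFun.comp ((continuous_scalarUnit_comp ?_).prodMk
        continuous_const)
      exact continuous_const.mul continuous_subtype_val⟩
  let ψ : (Matrix (p ⊕ q) (p ⊕ q) ℂ)ˣ × (Matrix (κ₁ ⊕ κ₂) (κ₁ ⊕ κ₂) ℂ)ˣ →ₜ*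
      (Matrix ((p ⊕ κ₁) ⊕ (q ⊕ κ₂)) ((p ⊕ κ₁) ⊕ (q ⊕ κ₂)) ℂ)ˣ :=
    (reindexHom e).comp blockDiag
  have hψ : ∀ A A', ψ (blockDiag A, blockDiag A') =
      blockDiag (blockDiag (A.1, A'.1), blockDiag (A.2, A'.2)) := fun A A' => Units.ext (by
    simp only [ψ, e]
    ext ((i | i) | (i | i)) ((j | j) | (j | j)) <;> simp)
  let u : Circle → (Matrix (κ₁ ⊕ κ₂) (κ₁ ⊕ κ₂) ℂ)ˣ := fun z =>
    blockDiag (scalarUnit _ (d z), scalarUnit _ (d 1))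
  have hFg : ∀ x, F x = g x.1 * blockDiag (scalarUnit _ (d x.2), scalarUnit _ (d 1)) *
      (g x.1)⁻¹ := fun x => by
    rw [eq_mul_inv_iff_mul_eq]
    refine Units.ext ?_
    have h1 := hg x.1.1 x.1.2
    rw [hs0] at h1
    have h2 : (blockDiag (scalarUnit p (d x.2), scalarUnit q (d 1)) : Matrix (p ⊕ q) (p ⊕ q) ℂ) =
        (1 + (x.2 : ℂ)) • (1 : Matrix (p ⊕ q) (p ⊕ q) ℂ) +
          ((x.2 : ℂ) - 1) • fromBlocks 1 0 0 (-1) := by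
      rw [blockDiag_apply, ← fromBlocks_one, fromBlocks_smul, fromBlocks_smul, fromBlocks_add,
        scalarUnit_apply, scalarUnit_apply]
      simp only [d, Units.val_mul, Units.val_mk0, Circle.toUnits_apply]
      congr 1
      · module
      · simp
      · simp
      · simp only [Circle.coe_one]
        module
    rw [Units.val_mul, Units.val_mul, hF, h2, add_mul, mul_add, smul_mul_assoc, smul_mul_assoc, h1,
      mul_smul_comm, mul_smul_comm, one_mul, mul_one]
  have hψF : ∀ x, ψ (F x, u x.2) = ψ (g x.1, 1) * D x.2 * (ψ (g x.1, 1))⁻¹ := fun x => by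
    have h1 : D x.2 = ψ (blockDiag (scalarUnit p (d x.2), scalarUnit q (d 1)), u x.2) := by
      rw [hψ, blockDiag_scalarUnit, blockDiag_scalarUnit]
      rfl
    rw [h1, ← map_inv, ← map_mul, ← map_mul, hFg]
    congr 1
    simp
  let K : Y × I → (Matrix ((p ⊕ κ₁) ⊕ (q ⊕ κ₂)) ((p ⊕ κ₁) ⊕ (q ⊕ κ₂)) ℂ)ˣ := fun x =>
    blockDiag (K₁ (unitInterval.symm x.2, x.1), K₂ (unitInterval.symm x.2, x.1))
  have hKc : Continuous K := blockDiag.continuous_toFun.comp (by fun_prop)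
  have hKD : ∀ x z, K x * D z = D z * K x := fun x z => Units.ext (by
    simp [K, D, fromBlocks_multiply, scalarUnit_apply])
  let g' : C(Y × I, (Matrix ((p ⊕ κ₁) ⊕ (q ⊕ κ₂)) ((p ⊕ κ₁) ⊕ (q ⊕ κ₂)) ℂ)ˣ) :=
    ⟨fun x => ψ (g x, 1) * (K x)⁻¹,
      (ψ.continuous_toFun.comp (g.continuous.prodMk continuous_const)).mul hKc.inv⟩
  have hg'A : ∀ x ∈ cylinder B, g' x = 1 := by
    have hK : ∀ A : (Matrix p p ℂ)ˣ × (Matrix q q ℂ)ˣ,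
        ψ (blockDiag A, 1) = blockDiag (stab p κ₁ A.1, stab q κ₂ A.2) := fun A => by
      have := hψ A 1
      rw [map_one] at this
      exact this
    rintro ⟨y, t⟩ (hy | rfl | rfl)
    · have hy : y ∈ B := hy
      have h1 := K₁.eq_fst (unitInterval.symm t) hy
      have h2 := K₂.eq_fst (unitInterval.symm t) hy
      simp only [ContinuousMap.comp_apply, (hB1 y hy).1, (hB1 y hy).2] at h1 h2
      have h3 : K (y, t) = 1 := by
        simp only [K, h1, h2]
        change blockDiag (stab p κ₁ 1, stab q κ₂ 1) = 1
        rw [map_one, map_one]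
        exact map_one blockDiag
      simp only [g', ContinuousMap.coe_mk, h3, hgB y hy, inv_one, mul_one]
      exact map_one ψ
    · have h3 : K (y, 0) = 1 := by
        simp only [K, unitInterval.symm_zero, ContinuousMap.HomotopyWith.apply_one,
          ContinuousMap.one_apply]
        exact map_one blockDiag
      simp only [g', ContinuousMap.coe_mk, h3, hg0, inv_one, mul_one]
      exact map_one ψ
    · simp only [g', ContinuousMap.coe_mk, hh, hK, K]
      simp
  let F' : C((Y × I) × Circle, (Matrix ((p ⊕ κ₁) ⊕ (q ⊕ κ₂)) ((p ⊕ κ₁) ⊕ (q ⊕ κ₂)) ℂ)ˣ) :=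
    ⟨fun x => ψ (F x, u x.2), by
      simp only [hψF]
      have : Continuous fun x : (Y × I) × Circle => ψ (g x.1, 1) :=
        ψ.continuous_toFun.comp ((g.continuous.comp continuous_fst).prodMk continuous_const)
      exact (this.mul (D.continuous.comp continuous_snd)).mul this.inv⟩
  have good : Good (y₀, 0) (cylinder B) F' := by
    refine good_conj (show ((y₀, 0) : Y × I) ∈ cylinder B from Or.inr (Or.inl rfl)) g' hg'A D
      fun x => ?_
    simp only [F', g', ContinuousMap.coe_mk, hψF]
    have h1 : (K x.1)⁻¹ * (D x.2 * K x.1) = D x.2 := by rw [← hKD, inv_mul_cancel_left]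
    conv_lhs => rw [← h1]
    group
  let v : Circle → (Matrix (κ₁ ⊕ κ₂) (κ₁ ⊕ κ₂) ℂ)ˣ := fun z =>
    blockDiag (scalarUnit _ z.toUnits, scalarUnit _ 1)
  have hv : v 1 = 1 := by
    simp only [v, map_one, scalarUnit]
    exact map_one blockDiag
  have huv : ∀ z, u z = scalarUnit _ (d 1) * v z := fun z => by
    simp only [u, v, d, ← blockDiag_scalarUnit]
    rw [← map_mul, Prod.mk_mul_mk]
    simp [scalarUnit]
  refine Good.of_stab (κ := κ₁ ⊕ κ₂) (Good.of_mul (fun _ => blockDiag (1, scalarUnit _ (d 1)))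
    (fun z => blockDiag (1, v z)) (by rw [hv]; exact map_one blockDiag)
    (F' := blockDiag.toContinuousMap.comp ⟨fun x => (F x, u x.2), ?_⟩) (fun x => ?_)
    (Good.of_reindex e good))
  · refine F.continuous.prodMk (blockDiag.continuous_toFun.comp ?_)
    refine (continuous_scalarUnit_comp ?_).prodMk continuous_const
    exact continuous_const.mul (continuous_subtype_val.comp continuous_snd)
  · change blockDiag (F x, u x.2) = blockDiag (1, _) * blockDiag (F x, 1) * blockDiag (1, v x.2)
    rw [← map_mul, ← map_mul, huv]
    simp

end BottPeriodicity

section BottPeriodicity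

open Matrix

variable {Y : Type*} [TopologicalSpace Y]

theorem exists_conj_fromBlocks {ι : Type} [Fintype ι] [DecidableEq ι] {s : Matrix ι ι ℂ}
    (hh : s.IsHermitian) (hs : s * s = 1) :
    ∃ (b : (Matrix ι ι ℂ)ˣ) (P : ι → Prop) (_ : DecidablePred P),
      ((b : Matrix ι ι ℂ) * s * (b⁻¹ : (Matrix ι ι ℂ)ˣ)).submatrix
        (Equiv.sumCompl P) (Equiv.sumCompl P) = fromBlocks 1 0 0 (-1) := by
  let U : (Matrix ι ι ℂ)ˣ := Unitary.toUnits hh.eigenvectorUnitary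
  let D : Matrix ι ι ℂ := diagonal (RCLike.ofReal ∘ hh.eigenvalues)
  have h1 : s = U * D * (U⁻¹ : (Matrix ι ι ℂ)ˣ) := hh.spectral_theorem
  have hD : (U⁻¹ : (Matrix ι ι ℂ)ˣ) * s * U = D := by
    rw [h1, ← mul_assoc, ← mul_assoc, Units.inv_mul, one_mul, mul_assoc, Units.inv_mul, mul_one]
  have hD2 : D * D = 1 := by
    rw [← hD]
    calc _ = (U⁻¹ : (Matrix ι ι ℂ)ˣ) * s * (U * (U⁻¹ : (Matrix ι ι ℂ)ˣ)) * s * U := by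
          simp only [mul_assoc]
      _ = (U⁻¹ : (Matrix ι ι ℂ)ˣ) * (s * s) * U := by
          rw [Units.mul_inv, mul_one, mul_assoc (_ : Matrix ι ι ℂ) s s]
      _ = 1 := by rw [hs, mul_one, Units.inv_mul]
  have hev : ∀ i, hh.eigenvalues i = 1 ∨ hh.eigenvalues i = -1 := fun i => by
    have := congrFun (congrFun hD2 i) i
    simp only [D, diagonal_mul_diagonal, diagonal_apply_eq, one_apply_eq,
      Function.comp_apply] at this
    rw [← mul_self_eq_one_iff]
    exact RCLike.ofReal_injective (K := ℂ) (by simpa using this)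
  refine ⟨U⁻¹, fun i => hh.eigenvalues i = 1, Classical.decPred _, ?_⟩
  rw [inv_inv, hD]
  ext (i | i) (j | j)
  · by_cases hij : i = j
    · subst hij
      simp [D, i.2]
    · have : (i : ι) ≠ j := fun h => hij (Subtype.ext h)
      simp [D, hij, this]
  · have : (i : ι) ≠ j := fun h => j.2 (h ▸ i.2)
    simp [D, this]
  · have : (i : ι) ≠ j := fun h => i.2 (h ▸ j.2)
    simp [D, this]
  · by_cases hij : i = j
    · subst hij
      simp [D, (hev i).resolve_left i.2]
    · have : (i : ι) ≠ j := fun h => hij (Subtype.ext h)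
      simp [D, hij, this]

theorem involutionGood [CompactSpace Y] {B : Set Y} (hY : AllStablyNull Y B) (y₀ : Y) :
    InvolutionGood (y₀, 0) (cylinder B) := by
  intro ι _ _ s hF hu hs hh hs2 hsA
  obtain ⟨b, P, _, hb⟩ := exists_conj_fromBlocks (hh (y₀, 0)) (hs2 (y₀, 0))
  let s' : Y × I → Matrix ({i // P i} ⊕ {i // ¬ P i}) ({i // P i} ⊕ {i // ¬ P i}) ℂ := fun x =>
    ((b : Matrix ι ι ℂ) * s x * (b⁻¹ : (Matrix ι ι ℂ)ˣ)).submatrix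
        (Equiv.sumCompl P) (Equiv.sumCompl P)
  let F' : C((Y × I) × Circle, (Matrix ι ι ℂ)ˣ) :=
    ⟨fun x => b * unitsMk _ hF hu x * b⁻¹, by fun_prop⟩
  refine Good.of_conj b (F' := F') (fun _ => rfl) (Good.of_reindex (Equiv.sumCompl P).symm
    (good_of_involution_fromBlocks hY y₀ s' ?_ ?_ ?_ _ ?_))
  · exact ((continuous_const.mul hs).mul continuous_const).matrix_submatrix _ _
  · intro x
    simp only [s']
    rw [submatrix_mul_equiv]
    have : (b : Matrix ι ι ℂ) * s x * (b⁻¹ : (Matrix ι ι ℂ)ˣ) *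
        ((b : Matrix ι ι ℂ) * s x * (b⁻¹ : (Matrix ι ι ℂ)ˣ)) = 1 := by
      calc _ = (b : Matrix ι ι ℂ) * s x * ((b⁻¹ : (Matrix ι ι ℂ)ˣ) * b) * s x *
            (b⁻¹ : (Matrix ι ι ℂ)ˣ) := by simp only [mul_assoc]
        _ = b * (s x * s x) * (b⁻¹ : (Matrix ι ι ℂ)ˣ) := by
          rw [Units.inv_mul, mul_one, mul_assoc (_ : Matrix ι ι ℂ) (s x) (s x)]
        _ = 1 := by rw [hs2, mul_one, Units.mul_inv]
    rw [this, submatrix_one_equiv]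
  · intro x hx
    simp only [s', hsA x hx, hb]
  · intro x
    change (((b : Matrix ι ι ℂ) * _ * (b⁻¹ : (Matrix ι ι ℂ)ˣ)).submatrix
        (Equiv.sumCompl P) (Equiv.sumCompl P)) = _
    rw [unitsMk_apply, mul_add, add_mul, mul_smul_comm, mul_smul_comm, smul_mul_assoc,
      smul_mul_assoc, mul_one, Units.mul_inv]
    ext i j
    simp [s', Matrix.one_apply]

end BottPeriodicity

section Fourier

open Polynomial

variable {X : Type*} [TopologicalSpace X]

/-- Evaluation at a point, as a ring homomorphism. -/
noncomputable def evalAt (x : X) : C(X, ℂ) →+* ℂ := (ContinuousMap.evalAlgHom ℂ ℂ x).toRingHom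

@[simp]
theorem evalAt_apply (x : X) (f : C(X, ℂ)) : evalAt x f = f x := rfl

/-- Functions on `X × S¹` that are Laurent polynomials in the circle variable. -/
def IsLaurent (g : C(X × Circle, ℂ)) : Prop :=
  ∃ (m : ℕ) (P : C(X, ℂ)[X]), ∀ p : X × Circle,
    (p.2 : ℂ) ^ m * g p = P.eval₂ (evalAt p.1) (p.2 : ℂ)

theorem IsLaurent.add {g h : C(X × Circle, ℂ)} (hg : IsLaurent g) (hh : IsLaurent h) :
    IsLaurent (g + h) := by
  obtain ⟨m, P, hP⟩ := hg
  obtain ⟨n, Q, hQ⟩ := hh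
  refine ⟨m + n, Polynomial.X ^ n * P + Polynomial.X ^ m * Q, fun p => ?_⟩
  rw [eval₂_add, eval₂_mul, eval₂_mul, eval₂_X_pow, eval₂_X_pow, ← hP, ← hQ,
    ContinuousMap.add_apply]
  ring

theorem IsLaurent.mul {g h : C(X × Circle, ℂ)} (hg : IsLaurent g) (hh : IsLaurent h) :
    IsLaurent (g * h) := by
  obtain ⟨m, P, hP⟩ := hg
  obtain ⟨n, Q, hQ⟩ := hh
  refine ⟨m + n, P * Q, fun p => ?_⟩
  rw [eval₂_mul, ← hP, ← hQ, ContinuousMap.mul_apply]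
  ring

theorem isLaurent_comp_fst (f : C(X, ℂ)) : IsLaurent (f.comp ContinuousMap.fst) :=
  ⟨0, C f, fun p => by simp⟩

/-- The circle coordinate. -/
def circleCoord (X : Type*) [TopologicalSpace X] : C(X × Circle, ℂ) :=
  ⟨fun p => p.2, continuous_subtype_val.comp continuous_snd⟩

theorem isLaurent_circleCoord : IsLaurent (circleCoord X) :=
  ⟨0, Polynomial.X, fun p => by simp [circleCoord]⟩

theorem isLaurent_star_circleCoord : IsLaurent (star (circleCoord X)) :=
  ⟨1, 1, fun p => by simp [circleCoord, Complex.mul_conj]⟩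

theorem exists_isLaurent_norm_sub_lt [CompactSpace X] [T2Space X] (f : C(X × Circle, ℂ)) {ε : ℝ}
    (hε : 0 < ε) : ∃ g, IsLaurent g ∧ ‖f - g‖ < ε := by
  let s : Set C(X × Circle, ℂ) :=
    insert (circleCoord X) (Set.range fun f : C(X, ℂ) => f.comp ContinuousMap.fst)
  have hs : (StarAlgebra.adjoin ℂ s).SeparatesPoints := by
    rintro ⟨x, z⟩ ⟨y, w⟩ h
    by_cases hzw : z = w
    · have hxy : x ≠ y := fun h' => h (by rw [h', hzw])
      obtain ⟨f, hf0, hf1, -⟩ := exists_continuous_zero_one_of_isClosed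
        (isClosed_singleton (x := x)) (isClosed_singleton (x := y)) (by simpa using hxy)
      let f' : C(X, ℂ) := ⟨fun x => (f x : ℂ), by fun_prop⟩
      refine ⟨_, ⟨f'.comp ContinuousMap.fst, StarAlgebra.subset_adjoin ℂ s (Or.inr ⟨f', rfl⟩),
        rfl⟩, ?_⟩
      have h0 : f x = 0 := hf0 rfl
      have h1 : f y = 1 := hf1 rfl
      simp [f', h0, h1]
    · refine ⟨_, ⟨circleCoord X, StarAlgebra.subset_adjoin ℂ s (Or.inl rfl), rfl⟩, ?_⟩
      exact fun h => hzw (Circle.ext h)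
  have h := ContinuousMap.starSubalgebra_topologicalClosure_eq_top_of_separatesPoints _ hs
  have hf : f ∈ closure (StarAlgebra.adjoin ℂ s : Set C(X × Circle, ℂ)) := by
    rw [← StarSubalgebra.topologicalClosure_coe, h]
    trivial
  obtain ⟨g, hg, hfg⟩ := Metric.mem_closure_iff.1 hf ε hε
  refine ⟨g, ?_, by rwa [← dist_eq_norm]⟩
  replace hg : g ∈ Algebra.adjoin ℂ (s ∪ star s) := by
    rw [← StarAlgebra.adjoin_toSubalgebra]
    exact hg
  clear hfg
  induction hg using Algebra.adjoin_induction with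
  | mem g hg =>
    rcases hg with (rfl | ⟨f, rfl⟩) | hg
    · exact isLaurent_circleCoord
    · exact isLaurent_comp_fst f
    · rcases hg with hg | ⟨f, hf⟩
      · rw [← star_star g, hg]
        exact isLaurent_star_circleCoord
      · rw [← star_star g, ← hf]
        exact isLaurent_comp_fst (star f)
  | algebraMap r => exact isLaurent_comp_fst (algebraMap ℂ C(X, ℂ) r)
  | add g h _ _ hg hh => exact hg.add hh
  | mul g h _ _ hg hh => exact hg.mul hh

theorem exists_laurent_approx [CompactSpace X] [T2Space X] {A : Set X} (f : C(X × Circle, ℂ))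
    (hf : ∀ x ∈ A, ∀ z, f (x, z) = 0) {ε : ℝ} (hε : 0 < ε) :
    ∃ N, ∀ m ≥ N, ∀ d ≥ N + m, ∃ a : ℕ → C(X, ℂ), (∀ k, ∀ x ∈ A, a k x = 0) ∧
      ∀ p : X × Circle,
        ‖(p.2 : ℂ) ^ m * f p - ∑ k ∈ Finset.range d, (p.2 : ℂ) ^ k * a k p.1‖ < ε := by
  obtain ⟨g, ⟨n, P, hP⟩, hg⟩ := exists_isLaurent_norm_sub_lt f (half_pos hε)
  have hg' : ∀ p, ‖f p - g p‖ < ε / 2 := fun p => ((f - g).norm_coe_le_norm p).trans_lt hg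
  have hm : ∀ x, 0 < max ‖g.curry x‖ (ε / 2) := fun x => lt_max_of_lt_right (half_pos hε)
  let l : C(X, ℂ) := ⟨fun x => ((1 - ε / 2 / max ‖g.curry x‖ (ε / 2) : ℝ) : ℂ), by
    refine Complex.continuous_ofReal.comp (continuous_const.sub (continuous_const.div ?_
      fun x => (hm x).ne'))
    exact (map_continuous g.curry).norm.max continuous_const⟩
  have hl : ∀ x ∈ A, l x = 0 := fun x hx => by
    have : ‖g.curry x‖ ≤ ε / 2 := (ContinuousMap.norm_le _ (half_pos hε).le).2 fun z => by
      have := hg' (x, z)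
      rw [hf x hx, zero_sub, norm_neg] at this
      exact this.le
    simp [l, max_eq_right this, hε.ne']
  have hlg : ∀ p : X × Circle, ‖g p - l p.1 * g p‖ ≤ ε / 2 := fun p => by
    have h1 : ‖g p‖ ≤ max ‖g.curry p.1‖ (ε / 2) :=
      le_max_of_le_left ((g.curry p.1).norm_coe_le_norm p.2)
    have h2 : g p - l p.1 * g p = ((ε / 2 / max ‖g.curry p.1‖ (ε / 2) : ℝ) : ℂ) * g p := by
      simp only [l, ContinuousMap.coe_mk]
      push_cast
      ring
    have h3 := hm p.1
    rw [h2, norm_mul, Complex.norm_real, Real.norm_of_nonneg (by positivity), div_mul_eq_mul_div,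
      div_le_iff₀ h3]
    exact mul_le_mul_of_nonneg_left h1 (half_pos hε).le
  refine ⟨max n (P.natDegree + 1), fun m hm d hd => ?_⟩
  have hnm : n ≤ m := (le_max_left _ _).trans hm
  let Q : C(X, ℂ)[X] := C l * (Polynomial.X ^ (m - n) * P)
  have hQd : Q.natDegree < d := by
    have h1 : Q.natDegree ≤ 0 + (m - n + P.natDegree) := natDegree_mul_le_of_le (by simp)
      (natDegree_mul_le_of_le (natDegree_X_pow_le _) le_rfl)
    have := le_max_right n (P.natDegree + 1)
    omega
  have hQ : ∀ p : X × Circle, Q.eval₂ (evalAt p.1) (p.2 : ℂ) = (p.2 : ℂ) ^ m * (l p.1 * g p) :=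
    fun p => by
      rw [eval₂_mul, eval₂_mul, eval₂_C, eval₂_X_pow, ← hP, evalAt_apply,
        ← Nat.sub_add_cancel hnm, pow_add]
      simp only [Nat.add_sub_cancel]
      ring
  refine ⟨fun k => Q.coeff k, fun k x hx => by simp [Q, coeff_C_mul, hl x hx], fun p => ?_⟩
  have : ∑ k ∈ Finset.range d, (p.2 : ℂ) ^ k * Q.coeff k p.1 = (p.2 : ℂ) ^ m * (l p.1 * g p) := by
    rw [← hQ, eval₂_eq_sum_range' _ hQd]
    exact Finset.sum_congr rfl fun k _ => mul_comm _ _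
  rw [this, ← mul_sub, norm_mul, norm_pow, Circle.norm_coe, one_pow, one_mul]
  calc ‖f p - l p.1 * g p‖ = ‖(f p - g p) + (g p - l p.1 * g p)‖ := by ring_nf
    _ ≤ _ := norm_add_le _ _
    _ < ε := by linarith [hg' p, hlg p]

end Fourier

section Fourier

open Matrix
open scoped Matrix.Norms.Elementwise

variable {X : Type*} [TopologicalSpace X] {ι : Type} [Fintype ι]

theorem exists_laurent_matrix_approx [CompactSpace X] [T2Space X] {A : Set X}
    (M : X × Circle → Matrix ι ι ℂ) (hM : Continuous M) (hA : ∀ x ∈ A, ∀ z, M (x, z) = 0)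
    {ε : ℝ} (hε : 0 < ε) :
    ∃ (m d : ℕ) (a : ℕ → X → Matrix ι ι ℂ), m ≤ d ∧ (∀ k, Continuous (a k)) ∧
      (∀ k, ∀ x ∈ A, a k x = 0) ∧ ∀ p : X × Circle,
        ‖(p.2 : ℂ) ^ m • M p - ∑ k ∈ Finset.range (d + 2), (p.2 : ℂ) ^ k • a k p.1‖ < ε := by
  choose N hN using fun i j => exists_laurent_approx (A := A)
    (⟨fun p => M p i j, hM.matrix_elem i j⟩ : C(X × Circle, ℂ))
    (fun x hx z => by simp [hA x hx]) hε
  let m := ∑ i, ∑ j, N i j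
  have hm : ∀ i j, N i j ≤ m := fun i j =>
    (Finset.single_le_sum (f := fun j => N i j) (fun _ _ => Nat.zero_le _)
      (Finset.mem_univ j)).trans
      (Finset.single_le_sum (f := fun i => ∑ j, N i j) (fun _ _ => Nat.zero_le _)
        (Finset.mem_univ i))
  choose a ha0 ha using fun i j => hN i j m (hm i j) (m + m + 2) (by have := hm i j; omega)
  refine ⟨m, m + m, fun k x => .of fun i j => a i j k x, by omega,
    fun k => continuous_matrix fun i j => (a i j k).continuous,
    fun k x hx => by ext i j; exact ha0 i j k x hx, fun p => ?_⟩
  rw [norm_lt_iff hε]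
  intro i j
  have := ha i j p
  simpa [Matrix.sum_apply] using this

variable [DecidableEq ι]

theorem exists_forall_isUnit_of_norm_sub_lt {Z : Type*} [TopologicalSpace Z] [CompactSpace Z]
    (F : C(Z, (Matrix ι ι ℂ)ˣ)) :
    ∃ ε > 0, ∀ z, ∀ M : Matrix ι ι ℂ, ‖(F z : Matrix ι ι ℂ) - M‖ < ε → IsUnit M := by
  have hc : IsCompact (Set.range fun z => (F z : Matrix ι ι ℂ)) :=
    isCompact_range (Units.continuous_val.comp F.continuous)
  obtain ⟨ε, hε, h⟩ := hc.exists_thickening_subset_open isOpen_isUnit (by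
    rintro _ ⟨z, rfl⟩
    exact (F z).isUnit)
  refine ⟨ε, hε, fun z M hM => h (Metric.mem_thickening_iff.2 ⟨_, ⟨z, rfl⟩, ?_⟩)⟩
  rwa [dist_comm, dist_eq_norm]

theorem good_of_linearGood [CompactSpace X] [T2Space X] {x₀ : X} {A : Set X} (hx₀ : x₀ ∈ A)
    (hlin : LinearGood x₀ A) (F : C(X × Circle, (Matrix ι ι ℂ)ˣ))
    (hF : ∀ x ∈ A, ∀ z, F (x, z) = 1) : Good x₀ A F := by
  have hFc : Continuous fun p => (F p : Matrix ι ι ℂ) := Units.continuous_val.comp F.continuous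
  obtain ⟨ε, hε, hu⟩ := exists_forall_isUnit_of_norm_sub_lt F
  obtain ⟨m, d, a, hmd, hac, haA, ha⟩ := exists_laurent_matrix_approx (A := A)
    (fun p => (F p : Matrix ι ι ℂ) - 1) (hFc.sub continuous_const)
    (fun x hx z => by simp [hF x hx]) hε
  let b : ℕ → X → Matrix ι ι ℂ := fun k x => a k x + if k = m then 1 else 0
  have hbc : ∀ k, Continuous (b k) := fun k => (hac k).add continuous_const
  have hbA : ∀ k, ∀ x ∈ A, b k x = b k x₀ := fun k x hx => by
    simp only [b, haA k x hx, haA k x₀ hx₀]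
  have hsum : ∀ p : X × Circle, ∑ k ∈ Finset.range (d + 2), (p.2 : ℂ) ^ k • b k p.1 =
      ∑ k ∈ Finset.range (d + 2), (p.2 : ℂ) ^ k • a k p.1 + (p.2 : ℂ) ^ m • 1 := fun p => by
    simp only [b, smul_add, Finset.sum_add_distrib, smul_ite, smul_zero, Finset.sum_ite_eq',
      Finset.mem_range]
    rw [if_pos (by omega)]
  let G : X × Circle → Matrix ι ι ℂ := fun p =>
    ∑ k ∈ Finset.range (d + 2), (p.2 : ℂ) ^ k • b k p.1
  have hz : Continuous fun p : X × Circle => (p.2 : ℂ) := continuous_subtype_val.comp continuous_snd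
  have hGc : Continuous G := continuous_finsetSum _ fun k _ =>
    (hz.pow k).smul ((hbc k).comp continuous_fst)
  have hG : ∀ p, ‖(p.2 : ℂ) ^ m • (F p : Matrix ι ι ℂ) - G p‖ < ε := fun p => by
    have := ha p
    simp only [G, hsum]
    rwa [smul_sub, sub_sub, add_comm (_ • (1 : Matrix ι ι ℂ))] at this
  have hunit : ∀ (t : I) (p : X × Circle),
      IsUnit ((1 - (t : ℂ)) • (p.2 : ℂ) ^ m • (F p : Matrix ι ι ℂ) + (t : ℂ) • G p) := fun t p => by
    have hz0 : (p.2 : ℂ) ^ m ≠ 0 := pow_ne_zero _ (Circle.coe_ne_zero _)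
    have h1 := hu p ((1 - (t : ℂ)) • (F p : Matrix ι ι ℂ) + (t : ℂ) • ((p.2 : ℂ) ^ m)⁻¹ • G p) (by
      have : (F p : Matrix ι ι ℂ) -
          ((1 - (t : ℂ)) • (F p : Matrix ι ι ℂ) + (t : ℂ) • ((p.2 : ℂ) ^ m)⁻¹ • G p) =
          ((t : ℂ) * ((p.2 : ℂ) ^ m)⁻¹) • ((p.2 : ℂ) ^ m • (F p : Matrix ι ι ℂ) - G p) := by
        rw [smul_sub, smul_smul _ _ (F p : Matrix ι ι ℂ), mul_assoc, inv_mul_cancel₀ hz0]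
        module
      rw [this, norm_smul, norm_mul, norm_inv, norm_pow, Circle.norm_coe, one_pow, inv_one, mul_one,
        Complex.norm_real, Real.norm_of_nonneg t.2.1]
      exact (mul_le_of_le_one_left (norm_nonneg _) t.2.2).trans_lt (hG p))
    have h2 := h1.smul (Units.mk0 _ hz0)
    rw [Units.smul_mk0, smul_add, smul_comm _ (1 - (t : ℂ)), smul_comm _ (t : ℂ),
      smul_smul _ _ (G p),
      mul_inv_cancel₀ hz0, one_smul] at h2
    exact h2
  have hGu : ∀ p, IsUnit (G p) := fun p => by simpa using hunit 1 p
  have hmc : Continuous fun p : X × Circle => scalarUnit ι (p.2.toUnits ^ m) :=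
    continuous_scalarUnit_comp (hz.pow m)
  refine Good.of_mul (fun _ => 1) (fun z => scalarUnit ι (z.toUnits ^ m))
    (by simp [scalarUnit])
    (F' := ⟨fun p => F p * scalarUnit ι (p.2.toUnits ^ m), F.continuous.mul hmc⟩)
    (fun p => by simp) ?_
  refine Good.of_homotopy (good_polynomial hlin d ι b hGc hGu hbc hbA)
    (fun q => (1 - ((q.1 : ℝ) : ℂ)) • (q.2.2 : ℂ) ^ m • (F q.2 : Matrix ι ι ℂ) +
      ((q.1 : ℝ) : ℂ) • G q.2) ?_ (fun q => hunit q.1 q.2) ?_ ?_ ?_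
  · have h1 : Continuous fun q : I × X × Circle => ((q.1 : ℝ) : ℂ) := by fun_prop
    have h2 : Continuous fun q : I × X × Circle => (q.2.2 : ℂ) ^ m :=
      (hz.comp continuous_snd).pow m
    exact ((continuous_const.sub h1).smul (h2.smul (hFc.comp continuous_snd))).add
      (h1.smul (hGc.comp continuous_snd))
  · intro p
    simp [scalarUnit_apply]
  · intro p
    simp [G]
  · intro t x hx z
    simp only [G, hF x hx, hF x₀ hx₀, hbA _ x hx]

end Fourier

section BottPeriodicity

open Polynomial

variable {X : Type*} [TopologicalSpace X]

/-- The quotient map closing up the interval to a circle. -/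
noncomputable def closeUp (X : Type*) [TopologicalSpace X] : C(X × I, X × Circle) :=
  ⟨fun p => (p.1, Circle.exp (2 * Real.pi * p.2)), by fun_prop⟩

theorem closeUp_eq_iff {p q : X × I} (h : closeUp X p = closeUp X q) :
    p = q ∨ p.1 = q.1 ∧ (p.2 = 0 ∨ p.2 = 1) ∧ (q.2 = 0 ∨ q.2 = 1) := by
  obtain ⟨x, s⟩ := p
  obtain ⟨y, t⟩ := q
  obtain ⟨rfl : x = y, h2 : Circle.exp _ = Circle.exp _⟩ := Prod.ext_iff.1 h
  obtain ⟨m, hm⟩ := Circle.exp_eq_exp.1 h2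
  have hst : (s : ℝ) = t + m := by
    have := Real.pi_pos
    field_simp at hm
    linarith
  have hs := s.2
  have ht := t.2
  have h3 : (m : ℝ) ≤ 1 := by linarith [hs.2, ht.1]
  have h4 : (-1 : ℝ) ≤ m := by linarith [hs.1, ht.2]
  have h3 : m ≤ 1 := by exact_mod_cast h3
  have h4 : -1 ≤ m := by exact_mod_cast h4
  obtain rfl | rfl | rfl : m = -1 ∨ m = 0 ∨ m = 1 := by omega
  · push_cast at hst
    exact Or.inr ⟨rfl, Or.inl (Subtype.ext (show (s : ℝ) = 0 by linarith [hs.1, ht.2])),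
      Or.inr (Subtype.ext (show (t : ℝ) = 1 by linarith [hs.1, ht.2]))⟩
  · left
    simp only [Int.cast_zero, add_zero] at hst
    rw [Subtype.ext hst]
  · push_cast at hst
    exact Or.inr ⟨rfl, Or.inr (Subtype.ext (show (s : ℝ) = 1 by linarith [hs.2, ht.1])),
      Or.inl (Subtype.ext (show (t : ℝ) = 0 by linarith [hs.2, ht.1]))⟩

theorem surjective_closeUp : Function.Surjective (closeUp X) := by
  rintro ⟨x, z⟩
  obtain ⟨t, ht, rfl⟩ : ∃ t ∈ I, Circle.exp (2 * Real.pi * t) = z := by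
    refine ⟨Int.fract (Complex.arg z / (2 * Real.pi)),
      ⟨Int.fract_nonneg _, (Int.fract_lt_one _).le⟩, ?_⟩
    conv_rhs => rw [← Circle.exp_arg z]
    refine Circle.exp_eq_exp.2 ⟨-⌊Complex.arg z / (2 * Real.pi)⌋, ?_⟩
    rw [Int.fract]
    have := Real.pi_pos
    push_cast
    field_simp
    ring
  exact ⟨(x, ⟨t, ht⟩), rfl⟩

theorem allStablyNull_cylinder_of_linearGood [CompactSpace X] [T2Space X] {x₀ : X} {A : Set X}
    (hx₀ : x₀ ∈ A) (hlin : LinearGood x₀ A) : AllStablyNull (X × I) (cylinder A) := by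
  intro ι _ _ f hf
  have hq : Topology.IsQuotientMap (closeUp X) :=
    (closeUp X).continuous.isClosedMap.isQuotientMap (closeUp X).continuous surjective_closeUp
  have hfac : Function.FactorsThrough f (closeUp X) := fun p q h => by
    rcases closeUp_eq_iff h with rfl | ⟨-, hp, hq⟩
    · rfl
    · rw [hf p (Or.inr hp), hf q (Or.inr hq)]
  have hF1 : ∀ p ∈ wedge A, hq.lift f hfac p = 1 := by
    intro p hp
    obtain ⟨p, rfl⟩ := surjective_closeUp p
    have h1 : hq.lift f hfac (closeUp X p) = f p :=
      congrFun (congrArg DFunLike.coe (hq.lift_comp f hfac)) p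
    rw [h1]
    refine hf p ?_
    rcases hp with hp | hp
    · exact Or.inl hp
    · have : closeUp X p = closeUp X (p.1, 0) := Prod.ext rfl (by
        rw [hp]
        simp [closeUp])
      rcases closeUp_eq_iff this with h | h
      · exact Or.inr (Or.inl (by rw [h]))
      · exact Or.inr h.2.1
  obtain ⟨κ, i1, i2, h⟩ := (good_of_linearGood hx₀ hlin (hq.lift f hfac) fun x hx z =>
    hF1 (x, z) (Or.inl hx)).stablyNull hx₀ hF1
  refine ⟨κ, i1, i2, ?_⟩
  have := HomotopicRel.comp_right (T := cylinder A) h (closeUp X) (by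
    rintro p (hp | hp | hp)
    · exact Or.inl hp
    · exact Or.inr (by simp [closeUp, hp])
    · exact Or.inr (by simp [closeUp, hp]))
  rwa [ContinuousMap.comp_assoc, hq.lift_comp] at this

variable {Y : Type*} [TopologicalSpace Y]

theorem isClosed_cylinder {B : Set Y} (hB : IsClosed B) : IsClosed (cylinder B) :=
  (hB.preimage continuous_fst).union ((isClosed_singleton.preimage continuous_snd).union
    (isClosed_singleton.preimage continuous_snd))

/-- Bott periodicity, in the form of a vanishing statement. -/
theorem AllStablyNull.cylinder_cylinder [CompactSpace Y] [T2Space Y] [Nonempty Y] {B : Set Y}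
    (hB : IsClosed B) (h : AllStablyNull Y B) :
    AllStablyNull ((Y × I) × I) (cylinder (cylinder B)) := by
  obtain ⟨y₀⟩ := ‹Nonempty Y›
  have h0 : ((y₀, 0) : Y × I) ∈ cylinder B := Or.inr (Or.inl rfl)
  exact allStablyNull_cylinder_of_linearGood h0
    (linearGood_of_involutionGood (isClosed_cylinder hB) h0 (involutionGood h y₀))

theorem joinedIn_one_isUnit {ι : Type} [Fintype ι] [DecidableEq ι] {A : Matrix ι ι ℂ}
    (hA : IsUnit A) : JoinedIn {M : Matrix ι ι ℂ | IsUnit M} A 1 := by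
  let P : ℂ[X] := (Matrix.of fun i j => C ((1 : Matrix ι ι ℂ) i j) + Polynomial.X *
    C ((A - 1) i j)).det
  have hP : ∀ z, P.eval z = (1 + z • (A - 1)).det := fun z => by
    rw [← coe_evalRingHom, RingHom.map_det]
    congr 1
    ext i j
    simp
  have h0 : P ≠ 0 := fun h => by
    have := hP 0
    simp [h] at this
  have hpath := (finite_setOfPred_isRoot h0).countable.isPathConnected_compl_of_one_lt_rank
    (E := ℂ) (by rw [Complex.rank_real_complex]; norm_num)
  obtain ⟨γ, hγ⟩ := hpath.joinedIn 1
    (by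
      have := (Matrix.isUnit_iff_isUnit_det A).1 hA
      simpa [IsRoot, hP] using this)
    0 (by simp [IsRoot, hP])
  refine ⟨(γ.map (f := fun z => 1 + z • (A - 1)) (by fun_prop)).cast (by simp) (by simp),
    fun t => ?_⟩
  have := hγ t
  change IsUnit (1 + γ t • (A - 1))
  rw [Matrix.isUnit_iff_isUnit_det, isUnit_iff_ne_zero, ← hP]
  exact this

theorem allStablyNull_unit : AllStablyNull Unit ∅ := by
  intro ι _ _ f _
  obtain ⟨γ, hγ⟩ := joinedIn_one_isUnit (f ()).isUnit
  refine StablyNull.of_homotopicRel (g := 1) ⟨⟨⟨unitsMk (fun p => γ p.1) (by fun_prop)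
    fun p => hγ p.1, fun x => ?_, fun x => ?_⟩, fun t x hx => hx.elim⟩⟩ (stablyNull_one _)
  · exact Units.ext (by simp)
  · exact Units.ext (by simp)

theorem allStablyNull_cube : AllStablyNull ((((Unit × I) × I) × I) × I)
    (cylinder (cylinder (cylinder (cylinder ∅)))) :=
  (allStablyNull_unit.cylinder_cylinder isClosed_empty).cylinder_cylinder
    (isClosed_cylinder (isClosed_cylinder isClosed_empty))

end BottPeriodicity

section GeneralPosition

variable {X E : Type*} [TopologicalSpace X] [CompactSpace X] [NormedAddCommGroup E]
  [NormedSpace ℝ E]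

theorem exists_contDiff_near (i : C(X, E)) (hi : Function.Injective i) (f : C(X, ℝ)) {ε : ℝ}
    (hε : 0 < ε) : ∃ F : E → ℝ, ContDiff ℝ 1 F ∧ ∀ x, |f x - F (i x)| < ε := by
  let S : Subalgebra ℝ C(X, ℝ) :=
    { carrier := {g | ∃ F : E → ℝ, ContDiff ℝ 1 F ∧ ∀ x, g x = F (i x)}
      mul_mem' := by
        rintro g h ⟨F, hF, hg⟩ ⟨G, hG, hh⟩
        exact ⟨fun y => F y * G y, hF.mul hG, fun x => by simp [hg, hh]⟩
      add_mem' := by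
        rintro g h ⟨F, hF, hg⟩ ⟨G, hG, hh⟩
        exact ⟨fun y => F y + G y, hF.add hG, fun x => by simp [hg, hh]⟩
      algebraMap_mem' := fun r => ⟨fun _ => r, contDiff_const, fun x => rfl⟩ }
  have hS : S.SeparatesPoints := fun x y hxy => by
    obtain ⟨l, hl⟩ := SeparatingDual.exists_separating_of_ne (R := ℝ) (hi.ne hxy)
    exact ⟨_, ⟨(l : C(E, ℝ)).comp i, ⟨l, l.contDiff, fun _ => rfl⟩, rfl⟩, hl⟩
  obtain ⟨⟨g, F, hF, hg⟩, hgf⟩ :=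
    ContinuousMap.exists_mem_subalgebra_near_continuousMap_of_separatesPoints S hS f ε hε
  refine ⟨F, hF, fun x => ?_⟩
  rw [← hg, abs_sub_comm]
  exact ((g - f).norm_coe_le_norm x).trans_lt hgf

theorem exists_contDiff_near_of_zero (i : C(X, E)) (hi : Function.Injective i) (f : C(X, ℝ))
    {ε : ℝ} (hε : 0 < ε) :
    ∃ F : E → ℝ, ContDiff ℝ 1 F ∧ (∀ x, f x = 0 → F (i x) = 0) ∧ ∀ x, |f x - F (i x)| < ε := by
  obtain ⟨δ, hδ, rfl⟩ : ∃ δ : ℝ, 0 < δ ∧ 3 * δ = ε := ⟨ε / 3, by positivity, by ring⟩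
  obtain ⟨P, hP, hPf⟩ := exists_contDiff_near i hi f hδ
  refine ⟨fun y => P y * Real.smoothTransition (P y ^ 2 / δ ^ 2 - 1), ?_, fun x hx => ?_,
    fun x => ?_⟩
  · exact hP.mul (Real.smoothTransition.contDiff.comp
      (((hP.pow 2).div_const _).sub contDiff_const))
  · have h1 := hPf x
    rw [hx, zero_sub, abs_neg] at h1
    have h2 : P (i x) ^ 2 / δ ^ 2 ≤ 1 := by
      rw [div_le_one (by positivity), sq_le_sq, abs_of_pos hδ]
      exact h1.le
    simp only
    rw [Real.smoothTransition.zero_of_nonpos (by linarith), mul_zero]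
  · have h1 := hPf x
    suffices h : |P (i x) - P (i x) * Real.smoothTransition (P (i x) ^ 2 / δ ^ 2 - 1)| ≤ 2 * δ by
      have := abs_sub_le (f x) (P (i x))
        (P (i x) * Real.smoothTransition (P (i x) ^ 2 / δ ^ 2 - 1))
      linarith
    generalize P (i x) = t
    rcases le_total |t| (2 * δ) with ht | ht
    · rw [← mul_one_sub, abs_mul]
      refine (mul_le_of_le_one_right (abs_nonneg _) ?_).trans ht
      have h3 := Real.smoothTransition.nonneg (t ^ 2 / δ ^ 2 - 1)
      have h4 := Real.smoothTransition.le_one (t ^ 2 / δ ^ 2 - 1)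
      rw [abs_le]
      constructor <;> linarith
    · have h2 : 2 ≤ t ^ 2 / δ ^ 2 := by
        rw [le_div_iff₀ (by positivity), ← sq_abs t]
        nlinarith
      rw [Real.smoothTransition.one_of_one_le (by linarith)]
      simp [hδ.le]

/-- A map into a vector space of large dimension can be perturbed so as to miss a ray, without
changing it where it is equal to a given vector. -/
theorem exists_near_avoiding_line [FiniteDimensional ℝ E] {κ : Type} [Fintype κ]
    (hdim : Module.finrank ℝ E + 1 < 2 * Fintype.card κ) (i : C(X, E)) (hi : Function.Injective i)
    (v : C(X, κ → ℂ)) (e : κ → ℂ) {ε : ℝ} (hε : 0 < ε) :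
    ∃ (u : C(X, κ → ℂ)) (w : κ → ℂ), (∀ x, v x = e → u x = e) ∧ (∀ x, ‖v x - u x‖ < ε) ∧
      ∀ x (r : ℝ), r • u x ≠ w := by
  choose R hR hR0 hRv using fun j => exists_contDiff_near_of_zero i hi
    (⟨fun x => (v x j - e j).re, by fun_prop⟩ : C(X, ℝ)) (half_pos hε)
  choose J hJ hJ0 hJv using fun j => exists_contDiff_near_of_zero i hi
    (⟨fun x => (v x j - e j).im, by fun_prop⟩ : C(X, ℝ)) (half_pos hε)
  let U : E → κ → ℂ := fun y j => e j + ((R j y : ℂ) + (J j y : ℂ) * Complex.I)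
  have hU : ContDiff ℝ 1 U := contDiff_pi.2 fun j => contDiff_const.add
    ((Complex.ofRealCLM.contDiff.comp (hR j)).add
      ((Complex.ofRealCLM.contDiff.comp (hJ j)).mul contDiff_const))
  have hΦ : ContDiff ℝ 1 fun p : E × ℝ => p.2 • U p.1 :=
    contDiff_snd.smul (hU.comp contDiff_fst)
  have hrank : Module.finrank ℝ (E × ℝ) < Module.finrank ℝ (κ → ℂ) := by
    rw [Module.finrank_prod, Module.finrank_self, Module.finrank_pi_fintype]
    simpa [Complex.finrank_real_complex, mul_comm] using hdim
  obtain ⟨w, hw⟩ := (hΦ.dense_compl_range_of_finrank_lt_finrank hrank).nonempty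
  refine ⟨⟨fun x => U (i x), hU.continuous.comp i.continuous⟩, w, fun x hx => ?_, fun x => ?_,
    fun x r h => hw ⟨(i x, r), h⟩⟩
  · ext j
    have h1 := hR0 j x (by simp [hx])
    have h2 := hJ0 j x (by simp [hx])
    simp [U, h1, h2]
  · rw [pi_norm_lt_iff hε]
    intro j
    have h1 := hRv j x
    have h2 := hJv j x
    refine (Complex.norm_le_abs_re_add_abs_im _).trans_lt ?_
    simp only [ContinuousMap.coe_mk, Complex.sub_re, Complex.sub_im] at h1 h2
    have h : v x j - U (i x) j =
        ⟨(v x j).re - (e j).re - R j (i x), (v x j).im - (e j).im - J j (i x)⟩ := by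
      apply Complex.ext <;> simp [U, sub_sub]
    change |(v x j - U (i x) j).re| + |(v x j - U (i x) j).im| < ε
    rw [h]
    linarith

end GeneralPosition

section Transport

open Matrix
open scoped ComplexOrder

theorem inner_bisector_ne_zero {V : Type*} [NormedAddCommGroup V] [InnerProductSpace ℂ V] {x y : V}
    (h : (‖y‖ : ℂ) • x + (‖x‖ : ℂ) • y ≠ 0) :
    inner ℂ ((‖y‖ : ℂ) • x + (‖x‖ : ℂ) • y) x ≠ 0 := by
  intro h0
  have h1 := congrArg Complex.re h0
  have hx2 : inner ℂ x x = (‖x‖ : ℂ) ^ 2 := inner_self_eq_norm_sq_to_K x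
  have hy2 : inner ℂ y y = (‖y‖ : ℂ) ^ 2 := inner_self_eq_norm_sq_to_K y
  have hsymm : (inner ℂ x y).re = (inner ℂ y x).re := by
    rw [← inner_conj_symm, Complex.conj_re]
  have h2 : (inner ℂ ((‖y‖ : ℂ) • x + (‖x‖ : ℂ) • y)
      ((‖y‖ : ℂ) • x + (‖x‖ : ℂ) • y)).re = 0 := by
    simp only [inner_add_left, inner_add_right, inner_smul_left, inner_smul_right,
      Complex.conj_ofReal,
      Complex.add_re, Complex.re_ofReal_mul, hx2, hy2, ← Complex.ofReal_pow, Complex.ofReal_re,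
      Complex.zero_re, hsymm] at h1 ⊢
    linear_combination (2 * ‖y‖) * h1
  apply h
  rw [← norm_eq_zero, ← sq_eq_zero_iff, @norm_sq_eq_re_inner ℂ]
  exact h2

variable {κ : Type} [Fintype κ]

/-- A covector that is nonzero on both of two given vectors which are not opposite. -/
noncomputable def bisector (a b : κ → ℂ) : κ → ℂ :=
  star ((‖WithLp.toLp 2 b‖ : ℂ) • a + (‖WithLp.toLp 2 a‖ : ℂ) • b)

theorem bisector_comm (a b : κ → ℂ) : bisector a b = bisector b a := by
  rw [bisector, bisector, add_comm]

theorem bisector_dotProduct_ne_zero {a b : κ → ℂ} (ha : a ≠ 0)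
    (h : ∀ r : ℝ, r • a ≠ -b) : bisector a b ⬝ᵥ a ≠ 0 := by
  have ha' : ‖WithLp.toLp 2 a‖ ≠ 0 := by simpa using ha
  rw [dotProduct_comm, bisector, ← EuclideanSpace.inner_toLp_toLp]
  refine inner_bisector_ne_zero (x := WithLp.toLp 2 a) (y := WithLp.toLp 2 b) fun h0 => ?_
  have h1 : (‖WithLp.toLp 2 b‖ : ℂ) • a + (‖WithLp.toLp 2 a‖ : ℂ) • b = 0 :=
    congrArg WithLp.ofLp h0
  refine h (‖WithLp.toLp 2 a‖⁻¹ * ‖WithLp.toLp 2 b‖) ?_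
  ext j
  have h2 := congrFun h1 j
  simp only [Pi.add_apply, Pi.smul_apply, smul_eq_mul, Pi.zero_apply, Pi.neg_apply,
    Complex.real_smul] at h2 ⊢
  push_cast
  have : (‖WithLp.toLp 2 a‖ : ℂ) ≠ 0 := by exact_mod_cast ha'
  field_simp
  linear_combination h2

theorem continuous_bisector {X : Type*} [TopologicalSpace X] {a : X → κ → ℂ} (ha : Continuous a)
    (b : κ → ℂ) : Continuous fun x => bisector (a x) b := by
  have h : Continuous fun x => ((‖WithLp.toLp 2 (a x)‖ : ℝ) : ℂ) := by fun_prop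
  exact (((continuous_const (y := (‖WithLp.toLp 2 b‖ : ℂ))).smul ha).add
    (h.smul continuous_const)).star

variable [DecidableEq κ]

/-- A matrix taking `a` to `b` and fixing the kernel of `l`. -/
noncomputable def transport (l a b : κ → ℂ) : Matrix κ κ ℂ :=
  1 + (l ⬝ᵥ a)⁻¹ • vecMulVec (b - a) l

theorem transport_mulVec {l a : κ → ℂ} (h : l ⬝ᵥ a ≠ 0) (b : κ → ℂ) :
    transport l a b *ᵥ a = b := by
  rw [transport, add_mulVec, one_mulVec, smul_mulVec, vecMulVec_mulVec]
  ext j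
  simp
  field_simp
  ring

theorem isUnit_transport {l a b : κ → ℂ} (ha : l ⬝ᵥ a ≠ 0) (hb : l ⬝ᵥ b ≠ 0) :
    IsUnit (transport l a b) := by
  rw [isUnit_iff_isUnit_det, isUnit_iff_ne_zero, transport, ← smul_vecMulVec,
    vecMulVec_eq Unit,
    det_one_add_replicateCol_mul_replicateRow, dotProduct_smul, dotProduct_sub, smul_eq_mul,
    mul_sub, inv_mul_cancel₀ ha]
  simp [ha, hb]

theorem continuous_transport {X : Type*} [TopologicalSpace X] {l a b : X → κ → ℂ}
    (hl : Continuous l) (ha : Continuous a) (hb : Continuous b) (h : ∀ x, l x ⬝ᵥ a x ≠ 0) :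
    Continuous fun x => transport (l x) (a x) (b x) :=
  continuous_const.add (((hl.dotProduct ha).inv₀ h).smul ((hb.sub ha).matrix_vecMulVec hl))

theorem exists_transport {X E : Type*} [TopologicalSpace X] [CompactSpace X] [NormedAddCommGroup E]
    [NormedSpace ℝ E] [FiniteDimensional ℝ E]
    (hdim : Module.finrank ℝ E + 1 < 2 * Fintype.card κ) (i : C(X, E)) (hi : Function.Injective i)
    (v : C(X, κ → ℂ)) (hv : ∀ x, v x ≠ 0) (x₀ : X) :
    ∃ T : C(X, (Matrix κ κ ℂ)ˣ), (∀ x, (T x : Matrix κ κ ℂ) *ᵥ v x = v x₀) ∧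
      ∀ x, v x = v x₀ → T x = 1 := by
  obtain ⟨ε, hε, hvu⟩ : ∃ ε > 0, ∀ x u, ‖v x - u‖ < ε → star (v x) ⬝ᵥ u ≠ 0 := by
    have hc : IsCompact (Set.range fun x => (v x, v x)) := isCompact_range (by fun_prop)
    obtain ⟨ε, hε, h⟩ := hc.exists_thickening_subset_open
      (isOpen_ne_fun (f := fun p : (κ → ℂ) × (κ → ℂ) => star p.1 ⬝ᵥ p.2) (g := fun _ => 0)
        (continuous_fst.star.dotProduct continuous_snd) continuous_const) (by
      rintro _ ⟨x, rfl⟩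
      exact fun h0 => hv x (dotProduct_star_self_eq_zero.1 h0))
    refine ⟨ε, hε, fun x u hu => h (a := (v x, u)) (Metric.mem_thickening_iff.2
      ⟨_, ⟨x, rfl⟩, ?_⟩)⟩
    rw [Prod.dist_eq, dist_self, dist_comm, dist_eq_norm]
    exact max_lt hε hu
  obtain ⟨u, w, huv, hvu', huw⟩ := exists_near_avoiding_line hdim i hi v (v x₀) hε
  have hvv : ∀ x, star (v x) ⬝ᵥ v x ≠ 0 := fun x => hvu x (v x) (by simpa using hε)
  have hvu : ∀ x, star (v x) ⬝ᵥ u x ≠ 0 := fun x => hvu x (u x) (hvu' x)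
  have hu0 : ∀ x, u x ≠ 0 := fun x h => hvu x (by simp [h])
  have hua : ∀ x, bisector (u x) (-w) ⬝ᵥ u x ≠ 0 := fun x =>
    bisector_dotProduct_ne_zero (hu0 x) (by simpa using huw x)
  have hub : ∀ x, bisector (u x) (-w) ⬝ᵥ (-w) ≠ 0 := fun x => by
    rw [bisector_comm]
    refine bisector_dotProduct_ne_zero (fun h => huw x 0 ?_) fun r hr => huw x r⁻¹ ?_
    · rw [zero_smul, ← neg_eq_zero.1 h]
    · rw [smul_neg, neg_inj] at hr
      have hr0 : r ≠ 0 := by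
        rintro rfl
        exact hu0 x (by rw [← hr, zero_smul])
      rw [← hr, inv_smul_smul₀ hr0]
  let T₁ := unitsMk (fun x => transport (star (v x)) (v x) (u x))
    (continuous_transport v.continuous.star v.continuous u.continuous hvv)
    fun x => isUnit_transport (hvv x) (hvu x)
  let T₂ := unitsMk (fun x => transport (bisector (u x) (-w)) (u x) (-w))
    (continuous_transport (continuous_bisector u.continuous _) u.continuous continuous_const hua)
    fun x => isUnit_transport (hua x) (hub x)
  have hT : ∀ x, ((T₂ x * T₁ x : (Matrix κ κ ℂ)ˣ) : Matrix κ κ ℂ) *ᵥ v x = -w := fun x => by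
    rw [Units.val_mul, ← mulVec_mulVec, unitsMk_apply, unitsMk_apply, transport_mulVec (hvv x),
      transport_mulVec (hua x)]
  refine ⟨⟨fun x => (T₂ x₀ * T₁ x₀)⁻¹ * (T₂ x * T₁ x), by fun_prop⟩, fun x => ?_, fun x hx => ?_⟩
  · change (((T₂ x₀ * T₁ x₀)⁻¹ * (T₂ x * T₁ x) : (Matrix κ κ ℂ)ˣ) : Matrix κ κ ℂ) *ᵥ v x = v x₀
    rw [Units.val_mul, ← mulVec_mulVec, hT, ← hT x₀, mulVec_mulVec, Units.inv_mul, one_mulVec]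
  · have h1 : T₁ x = T₁ x₀ := Units.ext (by simp [T₁, hx, huv x hx, huv x₀ rfl])
    have h2 : T₂ x = T₂ x₀ := Units.ext (by simp [T₂, huv x hx, huv x₀ rfl])
    simp [h1, h2]

end Transport

section Destabilization

open Matrix

variable {ι : Type} [Fintype ι] [DecidableEq ι] {n : ℕ} {S : Set (Fin n → I)}
  {f : C(Fin n → I, (Matrix ι ι ℂ)ˣ)}

theorem homotopicRel_one_of_stab_unit (hn : n < 2 * Fintype.card ι)
    (h : ((stab ι Unit).toContinuousMap.comp f).HomotopicRel 1 S) : f.HomotopicRel 1 S := by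
  obtain ⟨H⟩ := h
  let e : ι ⊕ Unit → ℂ := Pi.single (Sum.inr ()) 1
  let v : C(I × (Fin n → I), ι ⊕ Unit → ℂ) :=
    ⟨fun p => (H p : Matrix (ι ⊕ Unit) (ι ⊕ Unit) ℂ) *ᵥ e,
      (Units.continuous_val.comp H.continuous).matrix_mulVec continuous_const⟩
  have hstab (A : (Matrix ι ι ℂ)ˣ) :
      (stab ι Unit A : Matrix (ι ⊕ Unit) (ι ⊕ Unit) ℂ) *ᵥ e = e := by
    ext (j | j) <;> simp [e]
  have hv0 : ∀ x, v (0, x) = e := fun x => by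
    change (H (0, x) : Matrix (ι ⊕ Unit) (ι ⊕ Unit) ℂ) *ᵥ e = e
    rw [H.apply_zero]
    exact hstab _
  have hv1 : ∀ x, v (1, x) = e := fun x => by
    change (H (1, x) : Matrix (ι ⊕ Unit) (ι ⊕ Unit) ℂ) *ᵥ e = e
    rw [H.apply_one]
    simp
  have hvS : ∀ t, ∀ x ∈ S, v (t, x) = e := fun t x hx => by
    change (H (t, x) : Matrix (ι ⊕ Unit) (ι ⊕ Unit) ℂ) *ᵥ e = e
    rw [H.eq_fst t hx]
    exact hstab _
  let i : C(I × (Fin n → I), ℝ × (Fin n → ℝ)) := ⟨fun p => (p.1, fun j => p.2 j), by fun_prop⟩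
  obtain ⟨T, hT, hT1⟩ := exists_transport
    (by
      rw [Module.finrank_prod, Module.finrank_self, Module.finrank_fin_fun, Fintype.card_sum,
        Fintype.card_unit]
      omega) i
    (fun p q hpq => Prod.ext (Subtype.ext (Prod.ext_iff.1 hpq).1)
      (funext fun j => Subtype.ext (congrFun (Prod.ext_iff.1 hpq).2 j)))
    v (fun p h0 => by
      have h1 := congrArg (((H p)⁻¹ : (Matrix (ι ⊕ Unit) (ι ⊕ Unit) ℂ)ˣ).1 *ᵥ ·) h0
      have h2 : e = 0 := by simpa [v] using h1
      simpa [e] using congrFun h2 (Sum.inr ())) (0, 0)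
  rw [hv0] at hT hT1
  let G : C(I × (Fin n → I), (Matrix (ι ⊕ Unit) (ι ⊕ Unit) ℂ)ˣ) :=
    ⟨fun p => T p * H p, by fun_prop⟩
  have hG : ∀ p, (G p : Matrix (ι ⊕ Unit) (ι ⊕ Unit) ℂ) *ᵥ e = e := fun p => by
    change ((T p * H p : (Matrix (ι ⊕ Unit) (ι ⊕ Unit) ℂ)ˣ) : Matrix _ _ ℂ) *ᵥ e = e
    rw [Units.val_mul, ← mulVec_mulVec]
    exact hT p
  have hGH : ∀ p, v p = e → G p = H p := fun p hp => by
    change T p * H p = H p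
    rw [hT1 p hp, one_mul]
  have hblock : ∀ p, (G p : Matrix (ι ⊕ Unit) (ι ⊕ Unit) ℂ) =
      fromBlocks (G p : Matrix (ι ⊕ Unit) (ι ⊕ Unit) ℂ).toBlocks₁₁ 0
        (G p : Matrix (ι ⊕ Unit) (ι ⊕ Unit) ℂ).toBlocks₂₁ 1 := fun p => by
    have h1 : ∀ j, (G p : Matrix (ι ⊕ Unit) (ι ⊕ Unit) ℂ) j (Sum.inr ()) = e j := fun j => by
      simpa [e] using congrFun (hG p) j
    conv_lhs => rw [← fromBlocks_toBlocks (G p : Matrix (ι ⊕ Unit) (ι ⊕ Unit) ℂ)]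
    congr 1 <;> ext j k <;> simp [toBlocks₁₂, toBlocks₂₂, h1, e]
  have hunit : ∀ p, IsUnit (G p : Matrix (ι ⊕ Unit) (ι ⊕ Unit) ℂ).toBlocks₁₁ := fun p => by
    have := (G p).isUnit
    rw [hblock p, isUnit_fromBlocks_zero₁₂] at this
    exact this.1
  have hstart : ∀ t x A, v (t, x) = e → H (t, x) = stab ι Unit A →
      (G (t, x) : Matrix (ι ⊕ Unit) (ι ⊕ Unit) ℂ).toBlocks₁₁ = A := fun t x A hv hA => by
    rw [hGH _ hv, hA, stab_apply, toBlocks_fromBlocks₁₁]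
  have hcont : Continuous fun p => (G p : Matrix (ι ⊕ Unit) (ι ⊕ Unit) ℂ).toBlocks₁₁ :=
    (Units.continuous_val.comp G.continuous).matrix_submatrix Sum.inl Sum.inl
  exact ⟨⟨⟨unitsMk _ hcont hunit,
    fun x => Units.ext (hstart 0 x (f x) (hv0 x) (H.apply_zero x)),
    fun x => Units.ext (hstart 1 x 1 (hv1 x) ((H.apply_one x).trans (map_one _).symm))⟩,
    fun t x hx => Units.ext (hstart t x (f x) (hvS t x hx) (H.eq_fst t hx))⟩⟩

theorem homotopicRel_one_of_stab_fin (hn : n < 2 * Fintype.card ι) (m : ℕ)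
    (h : ((stab ι (Fin m)).toContinuousMap.comp f).HomotopicRel 1 S) : f.HomotopicRel 1 S := by
  induction m with
  | zero =>
    convert! homotopicRel_comp_one h (reindexHom (Equiv.sumEmpty ι (Fin 0))) using 1
  | succ m ih =>
    refine ih (homotopicRel_one_of_stab_unit (hn.trans_le ?_) ?_)
    · rw [Fintype.card_sum]
      omega
    convert! homotopicRel_comp_one h (reindexHom ((Equiv.sumCongr (Equiv.refl ι)
      (finSuccEquivLast.trans (Equiv.optionEquivSumPUnit (Fin m)))).trans
        (Equiv.sumAssoc ι (Fin m) Unit).symm)) using 1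
    ext x i j
    rcases i with (i | i) | i <;> rcases j with (j | j) | j <;>
      simp [Matrix.one_apply, Fin.castSucc_ne_last, (Fin.castSucc_ne_last _).symm]

theorem StablyNull.homotopicRel_one (hn : n < 2 * Fintype.card ι) (h : StablyNull S f) :
    f.HomotopicRel 1 S := by
  obtain ⟨κ, _, _, h⟩ := h
  refine homotopicRel_one_of_stab_fin hn (Fintype.card κ) ?_
  convert! homotopicRel_comp_one h (reindexHom (Equiv.sumCongr (Equiv.refl ι)
    (Fintype.equivFin κ))) using 1
  ext x i j
  rcases i with i | i <;> rcases j with j | j <;> simp [Matrix.one_apply]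

end Destabilization

section Retraction

open Matrix
open scoped Matrix.Norms.L2Operator

variable {ι : Type} [Fintype ι] [DecidableEq ι]

/-- The unitary factor of the polar decomposition of an invertible matrix. -/
noncomputable def polar (A : Matrix ι ι ℂ) : Matrix ι ι ℂ :=
  A * cfc (fun t : ℝ => (√t)⁻¹) (star A * A)

theorem continuousOn_inv_sqrt : ContinuousOn (fun t : ℝ => (√t)⁻¹) (Set.Ioi 0) :=
  Real.continuous_sqrt.continuousOn.inv₀ fun _ ht => (Real.sqrt_pos.2 ht).ne'

theorem spectrum_star_mul_self_pos {A : Matrix ι ι ℂ} (hA : IsUnit A) :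
    spectrum ℝ (star A * A) ⊆ Set.Ioi 0 := fun t ht =>
  lt_of_le_of_ne (spectrum_star_mul_self_nonneg t ht)
    (Ne.symm (spectrum_subset_compl_zero (hA.star.mul hA) ht))

theorem polar_mem_unitaryGroup {A : Matrix ι ι ℂ} (hA : IsUnit A) :
    polar A ∈ unitaryGroup ι ℂ := by
  have hc := continuousOn_inv_sqrt.mono (spectrum_star_mul_self_pos hA)
  have e1 : star (cfc (fun t : ℝ => (√t)⁻¹) (star A * A)) =
      cfc (fun t : ℝ => (√t)⁻¹) (star A * A) :=
    cfc_predicate (R := ℝ) (fun t : ℝ => (√t)⁻¹) (star A * A)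
  have hc' : ContinuousOn (fun t : ℝ => t * (√t)⁻¹) (spectrum ℝ (star A * A)) :=
    continuousOn_id.mul hc
  rw [mem_unitaryGroup_iff', polar, star_mul, e1, mul_assoc, ← mul_assoc (star A)]
  conv_lhs => enter [2, 1]; rw [← cfc_id' ℝ (star A * A)]
  rw [← cfc_mul _ _ _ (by fun_prop) hc, ← cfc_mul _ _ _ hc hc',
    ← cfc_one ℝ (star A * A) (IsSelfAdjoint.star_mul_self A)]
  refine cfc_congr fun t ht => ?_
  have ht : 0 < t := spectrum_star_mul_self_pos hA ht
  have h0 := (Real.sqrt_pos.2 ht).ne'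
  simp only [Pi.one_apply]
  field_simp
  exact (Real.sq_sqrt ht.le).symm

theorem polar_of_mem_unitaryGroup {A : Matrix ι ι ℂ} (hA : A ∈ unitaryGroup ι ℂ) :
    polar A = A := by
  rw [polar, mem_unitaryGroup_iff'.1 hA, cfc_apply_one]
  simp

theorem continuous_polar : Continuous fun A : (Matrix ι ι ℂ)ˣ => polar (A : Matrix ι ι ℂ) := by
  have h : Continuous fun A : (Matrix ι ι ℂ)ˣ => star (A : Matrix ι ι ℂ) * A :=
    Units.continuous_val.star.mul Units.continuous_val
  refine Units.continuous_val.mul (Continuous.cfc_of_mem_nhdsSet (s := Set.Ioi 0) _ ?_ h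
    (fun A => IsSelfAdjoint.star_mul_self _) continuousOn_inv_sqrt)
  exact isOpen_Ioi.mem_nhdsSet.2 (Set.iUnion_subset fun A => spectrum_star_mul_self_pos A.isUnit)

/-- The diagonal matrix with entry `z` at `i` and `1` elsewhere. -/
def diagonalSingle (i : ι) (z : ℂ) : Matrix ι ι ℂ := diagonal (Function.update 1 i z)

theorem det_diagonalSingle (i : ι) (z : ℂ) : (diagonalSingle i z).det = z := by
  rw [diagonalSingle, det_diagonal, Finset.prod_update_of_mem (Finset.mem_univ i)]
  simp

theorem diagonalSingle_mem_unitaryGroup (i : ι) {z : ℂ} (hz : z ∈ unitary ℂ) :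
    diagonalSingle i z ∈ unitaryGroup ι ℂ := by
  rw [mem_unitaryGroup_iff, diagonalSingle, star_eq_conjTranspose, diagonal_conjTranspose,
    diagonal_mul_diagonal, ← diagonal_one]
  congr 1
  ext j
  rcases eq_or_ne j i with rfl | h
  · simpa using (Unitary.mem_iff.1 hz).2
  · simp [h]

/-- A retraction of the general linear group onto the special unitary group. -/
noncomputable def specialUnitaryRetraction (i : ι) :
    C((Matrix ι ι ℂ)ˣ, specialUnitaryGroup ι ℂ) where
  toFun A := ⟨polar (A : Matrix ι ι ℂ) * diagonalSingle i (star (polar (A : Matrix ι ι ℂ)).det), by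
    have hp := polar_mem_unitaryGroup A.isUnit
    have hd := det_of_mem_unitary hp
    refine mem_specialUnitaryGroup_iff.2 ⟨mul_mem hp (diagonalSingle_mem_unitaryGroup i
      (Unitary.star_mem hd)), ?_⟩
    rw [det_mul, det_diagonalSingle]
    exact (Unitary.mem_iff.1 hd).2⟩
  continuous_toFun := by
    refine Continuous.subtype_mk (continuous_polar.mul (Continuous.matrix_diagonal ?_)) _
    exact continuous_const.update i continuous_polar.matrix_det.star

theorem specialUnitaryRetraction_apply (i : ι) {A : (Matrix ι ι ℂ)ˣ}
    {B : specialUnitaryGroup ι ℂ} (h : (A : Matrix ι ι ℂ) = B) :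
    specialUnitaryRetraction i A = B := by
  obtain ⟨h1, h2⟩ := mem_specialUnitaryGroup_iff.1 B.2
  refine Subtype.ext ?_
  change polar (A : Matrix ι ι ℂ) * diagonalSingle i (star (polar (A : Matrix ι ι ℂ)).det) = B
  rw [h, polar_of_mem_unitaryGroup h1, h2, star_one, diagonalSingle]
  simp

/-- The inclusion of the special unitary group into the general linear group. -/
noncomputable def specialUnitaryInclusion (ι : Type) [Fintype ι] [DecidableEq ι] :
    C(specialUnitaryGroup ι ℂ, (Matrix ι ι ℂ)ˣ) :=
  unitsMk (fun B => B) continuous_subtype_val fun B => by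
    rw [isUnit_iff_isUnit_det, (mem_specialUnitaryGroup_iff.1 B.2).2]
    exact isUnit_one

theorem retraction_comp_inclusion (i : ι) :
    (specialUnitaryRetraction i).comp (specialUnitaryInclusion ι) = ContinuousMap.id _ :=
  ContinuousMap.ext fun _ => specialUnitaryRetraction_apply i rfl

end Retraction

section Cube

/-- The four-dimensional cube as an iterated product with the interval. -/
def cubeToProd : C(Fin 4 → I, (((Unit × I) × I) × I) × I) :=
  ⟨fun y => (((((), y 0), y 1), y 2), y 3), by fun_prop⟩

/-- The inverse of `cubeToProd`. -/
def prodToCube : C((((Unit × I) × I) × I) × I, Fin 4 → I) :=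
  ⟨fun p => ![p.1.1.1.2, p.1.1.2, p.1.2, p.2], by
    refine continuous_pi fun j => ?_
    fin_cases j <;> simp <;> fun_prop⟩

theorem prodToCube_comp_cubeToProd :
    prodToCube.comp cubeToProd = ContinuousMap.id (Fin 4 → I) := by
  ext y j
  fin_cases j <;> rfl

theorem cubeToProd_mem {y : Fin 4 → I} (hy : y ∈ Cube.boundary (Fin 4)) :
    cubeToProd y ∈ cylinder (cylinder (cylinder (cylinder (∅ : Set Unit)))) := by
  obtain ⟨j, hj⟩ := hy
  fin_cases j
  · exact Or.inl (Or.inl (Or.inl (Or.inr hj)))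
  · exact Or.inl (Or.inl (Or.inr hj))
  · exact Or.inl (Or.inr hj)
  · exact Or.inr hj

theorem prodToCube_mem {p : (((Unit × I) × I) × I) × I}
    (hp : p ∈ cylinder (cylinder (cylinder (cylinder (∅ : Set Unit))))) :
    prodToCube p ∈ Cube.boundary (Fin 4) := by
  rcases hp with ((((hp | hp) | hp) | hp) | hp)
  · exact hp.elim
  · exact ⟨0, hp⟩
  · exact ⟨1, hp⟩
  · exact ⟨2, hp⟩
  · exact ⟨3, hp⟩

theorem homotopicRel_one_of_four_cube {ι : Type} [Fintype ι] [DecidableEq ι]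
    (hι : 4 < 2 * Fintype.card ι) {f : C(Fin 4 → I, (Matrix ι ι ℂ)ˣ)}
    (hf : ∀ y ∈ Cube.boundary (Fin 4), f y = 1) : f.HomotopicRel 1 (Cube.boundary (Fin 4)) := by
  obtain ⟨κ, i1, i2, h⟩ := allStablyNull_cube ι (f.comp prodToCube)
    fun p hp => hf _ (prodToCube_mem hp)
  refine StablyNull.homotopicRel_one hι ⟨κ, i1, i2, ?_⟩
  have := HomotopicRel.comp_right h cubeToProd fun y hy => cubeToProd_mem hy
  rwa [ContinuousMap.comp_assoc, ContinuousMap.comp_assoc, prodToCube_comp_cubeToProd] at this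

theorem genLoop_homotopic_const {ι : Type} [Fintype ι] [DecidableEq ι] [Nonempty ι]
    (hι : 4 < 2 * Fintype.card ι)
    (f : GenLoop (Fin 4) (Matrix.specialUnitaryGroup ι ℂ) 1) :
    GenLoop.Homotopic f GenLoop.const := by
  obtain ⟨i⟩ := ‹Nonempty ι›
  have h := (homotopicRel_one_of_four_cube hι (f := (specialUnitaryInclusion ι).comp f.1)
    fun y hy => Units.ext (congrArg Subtype.val (f.2 y hy))).comp_continuousMap
      (specialUnitaryRetraction i)
  rw [← ContinuousMap.comp_assoc, retraction_comp_inclusion, ContinuousMap.id_comp] at h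
  have h1 : (specialUnitaryRetraction i).comp (1 : C(Fin 4 → I, (Matrix ι ι ℂ)ˣ)) =
      (GenLoop.const : GenLoop (Fin 4) (Matrix.specialUnitaryGroup ι ℂ) 1).1 :=
    ContinuousMap.ext fun y => specialUnitaryRetraction_apply i rfl
  rwa [h1] at h

end Cube

end StableGL

/-- The fourth homotopy group of `SU(8)` based at the identity is trivial. -/
theorem pi4_SU8_trivial :
    Subsingleton (π_ 4 (Matrix.specialUnitaryGroup (Fin 8) ℂ) 1) := by
  have h := StableGL.genLoop_homotopic_const (ι := Fin 8) (by simp)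
  refine ⟨fun a b => Quotient.inductionOn₂ a b fun f g => Quotient.sound ?_⟩
  exact (h f).trans (h g).symm
end

section
/- There exists a surjective continuous group homomorphism ρ : Sp(2) → SO(5, ℝ) whose kernel is exactly {1, −1}; in particular Sp(2)/{±1} is isomorphic to SO(5) as a topological group (the isomorphism Sp(2) ≅ Spin(5) of Lie groups induces Sp(2)/ℤ₂ ≅ SO(5)). -/
/-- The compact symplectic group `Sp(n)`: the group of unitary `n × n` matrices over the
real quaternions, i.e. matrices `A` with `A * Aᴴ = 1`. -/
abbrev Sp (n : ℕ) : Type :=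
  unitary (Matrix (Fin n) (Fin n) (Quaternion ℝ))

open scoped Quaternion Matrix

namespace SpinFive

/-- The real quaternion with the given components. -/
def quat (a b c d : ℝ) : ℍ[ℝ] := ⟨a, b, c, d⟩

@[simp] theorem quat_re (a b c d : ℝ) : (quat a b c d).re = a := rfl

@[simp] theorem quat_imI (a b c d : ℝ) : (quat a b c d).imI = b := rfl

@[simp] theorem quat_imJ (a b c d : ℝ) : (quat a b c d).imJ = c := rfl

@[simp] theorem quat_imK (a b c d : ℝ) : (quat a b c d).imK = d := rfl

/-- The identification of `ℝ⁵` with the traceless Hermitian `2 × 2` quaternionic matrices. -/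
def gamma : (Fin 5 → ℝ) →ₗ[ℝ] Matrix (Fin 2) (Fin 2) ℍ[ℝ] where
  toFun v := !![quat (v 0) 0 0 0, quat (v 1) (v 2) (v 3) (v 4);
    quat (v 1) (-v 2) (-v 3) (-v 4), quat (-v 0) 0 0 0]
  map_add' v w := by
    ext i j <;> fin_cases i <;> fin_cases j <;> simp <;> ring
  map_smul' c v := by
    ext i j <;> fin_cases i <;> fin_cases j <;> simp

@[simp] theorem gamma_zero_zero (v : Fin 5 → ℝ) : gamma v 0 0 = quat (v 0) 0 0 0 := rfl

@[simp] theorem gamma_zero_one (v : Fin 5 → ℝ) :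
    gamma v 0 1 = quat (v 1) (v 2) (v 3) (v 4) := rfl

@[simp] theorem gamma_one_zero (v : Fin 5 → ℝ) :
    gamma v 1 0 = quat (v 1) (-v 2) (-v 3) (-v 4) := rfl

@[simp] theorem gamma_one_one (v : Fin 5 → ℝ) : gamma v 1 1 = quat (-v 0) 0 0 0 := rfl

/-- The linear left inverse of `gamma` reading off coordinates from the first row. -/
def coords : Matrix (Fin 2) (Fin 2) ℍ[ℝ] →ₗ[ℝ] (Fin 5 → ℝ) where
  toFun X := ![(X 0 0).re, (X 0 1).re, (X 0 1).imI, (X 0 1).imJ, (X 0 1).imK]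
  map_add' X Y := by ext i; fin_cases i <;> simp
  map_smul' c X := by ext i; fin_cases i <;> simp

theorem coords_gamma (v : Fin 5 → ℝ) : coords (gamma v) = v := by
  ext i; fin_cases i <;> simp [coords]

theorem gamma_injective : Function.Injective gamma :=
  Function.LeftInverse.injective coords_gamma

theorem gamma_coords {X : Matrix (Fin 2) (Fin 2) ℍ[ℝ]} (h : star X = X)
    (ht : X.trace.re = 0) : gamma (coords X) = X := by
  have h00 := congr_fun (congr_fun h 0) 0
  have h01 := congr_fun (congr_fun h 0) 1
  have h10 := congr_fun (congr_fun h 1) 0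
  have h11 := congr_fun (congr_fun h 1) 1
  simp only [Matrix.star_apply, Quaternion.ext_iff, Quaternion.re_star, Quaternion.imI_star,
    Quaternion.imJ_star, Quaternion.imK_star] at h00 h01 h10 h11
  simp only [Matrix.trace_fin_two, Quaternion.re_add] at ht
  ext i j <;> fin_cases i <;> fin_cases j <;> simp [coords] <;> linarith

theorem star_gamma (v : Fin 5 → ℝ) : star (gamma v) = gamma v := by
  ext i j <;> fin_cases i <;> fin_cases j <;> simp [Matrix.star_apply]

theorem re_trace_gamma (v : Fin 5 → ℝ) : (gamma v).trace.re = 0 := by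
  simp [Matrix.trace_fin_two]

/-- The Clifford relation. -/
theorem gamma_mul_add_mul (v w : Fin 5 → ℝ) :
    gamma v * gamma w + gamma w * gamma v = (2 * (v ⬝ᵥ w)) • 1 := by
  ext i j <;> fin_cases i <;> fin_cases j <;>
    simp [dotProduct, Fin.sum_univ_five, Matrix.mul_apply] <;> ring

theorem gamma_mul_self (v : Fin 5 → ℝ) : gamma v * gamma v = (v ⬝ᵥ v) • 1 := by
  have h := gamma_mul_add_mul v v
  rw [← two_smul ℝ, mul_smul] at h
  exact smul_right_injective _ (two_ne_zero (α := ℝ)) h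

theorem re_trace_mul_comm (X Y : Matrix (Fin 2) (Fin 2) ℍ[ℝ]) :
    (X * Y).trace.re = (Y * X).trace.re := by
  simp [Matrix.trace_fin_two, Matrix.mul_apply]; ring

theorem re_trace_gamma_prod (v : Matrix (Fin 5) (Fin 5) ℝ) :
    (gamma (v 0) * gamma (v 1) * gamma (v 2) * gamma (v 3) * gamma (v 4)).trace.re =
      -2 * v.det := by
  simp [Matrix.trace_fin_two, Matrix.mul_apply, Matrix.det_succ_row_zero, Fin.sum_univ_succ,
    Fin.succAbove, Matrix.submatrix]
  ring

/-- The matrix of the action `X ↦ A X A⋆` in the coordinates `gamma`. -/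
noncomputable def conjMatrix (A : Matrix (Fin 2) (Fin 2) ℍ[ℝ]) : Matrix (Fin 5) (Fin 5) ℝ :=
  LinearMap.toMatrix' (coords ∘ₗ LinearMap.mulRight ℝ (star A) ∘ₗ LinearMap.mulLeft ℝ A ∘ₗ gamma)

theorem conjMatrix_mulVec (A : Matrix (Fin 2) (Fin 2) ℍ[ℝ]) (v : Fin 5 → ℝ) :
    conjMatrix A *ᵥ v = coords (A * gamma v * star A) := by
  rw [conjMatrix, LinearMap.toMatrix'_mulVec]
  simp

theorem gamma_conjMatrix_mulVec (A : Sp 2) (v : Fin 5 → ℝ) :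
    gamma (conjMatrix A.1 *ᵥ v) = A.1 * gamma v * star A.1 := by
  rw [conjMatrix_mulVec, gamma_coords]
  · simp only [star_mul, star_star, star_gamma, mul_assoc]
  · rw [re_trace_mul_comm, ← mul_assoc, Unitary.coe_star_mul_self, one_mul, re_trace_gamma]

theorem eq_of_gamma_mulVec {M N : Matrix (Fin 5) (Fin 5) ℝ}
    (h : ∀ v, gamma (M *ᵥ v) = gamma (N *ᵥ v)) : M = N :=
  Matrix.ext_iff_mulVec.mpr fun v => gamma_injective (h v)

theorem conjMatrix_one : conjMatrix 1 = 1 :=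
  eq_of_gamma_mulVec fun v => by simpa using gamma_conjMatrix_mulVec 1 v

theorem conjMatrix_mul (A B : Sp 2) :
    conjMatrix (A * B).1 = conjMatrix A.1 * conjMatrix B.1 :=
  eq_of_gamma_mulVec fun v => by
    rw [← Matrix.mulVec_mulVec, gamma_conjMatrix_mulVec, gamma_conjMatrix_mulVec,
      gamma_conjMatrix_mulVec, Submonoid.coe_mul, star_mul]
    simp only [mul_assoc]

theorem conj_mul_conj (A : Sp 2) (X Y : Matrix (Fin 2) (Fin 2) ℍ[ℝ]) :
    (A.1 * X * star A.1) * (A.1 * Y * star A.1) = A.1 * (X * Y) * star A.1 := by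
  simp only [mul_assoc]
  rw [← mul_assoc (star A.1) A.1, Unitary.coe_star_mul_self, one_mul]

theorem conjMatrix_dotProduct (A : Sp 2) (v w : Fin 5 → ℝ) :
    conjMatrix A.1 *ᵥ v ⬝ᵥ conjMatrix A.1 *ᵥ w = v ⬝ᵥ w := by
  have h := gamma_mul_add_mul (conjMatrix A.1 *ᵥ v) (conjMatrix A.1 *ᵥ w)
  rw [gamma_conjMatrix_mulVec, gamma_conjMatrix_mulVec, conj_mul_conj, conj_mul_conj,
    ← add_mul, ← mul_add, gamma_mul_add_mul, mul_smul_comm, mul_one, smul_mul_assoc,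
    Unitary.mul_star_self_of_mem A.2] at h
  have h00 := congr_arg (fun q : ℍ[ℝ] => q.re) (congr_fun (congr_fun h 0) 0)
  simp at h00
  exact h00.symm

theorem conjMatrix_transpose_mul_self (A : Sp 2) : (conjMatrix A.1)ᵀ * conjMatrix A.1 = 1 := by
  refine Matrix.ext_iff_mulVec.mpr fun v => dotProduct_eq _ _ fun w => ?_
  rw [← Matrix.mulVec_mulVec, Matrix.one_mulVec, dotProduct_comm, Matrix.dotProduct_mulVec,
    Matrix.vecMul_transpose, conjMatrix_dotProduct, dotProduct_comm]

theorem det_conjMatrix (A : Sp 2) : (conjMatrix A.1).det = 1 := by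
  have h := re_trace_gamma_prod (conjMatrix A.1)ᵀ
  have h1 := re_trace_gamma_prod 1
  have hrow (i : Fin 5) : (conjMatrix A.1)ᵀ i =
      conjMatrix A.1 *ᵥ (1 : Matrix (Fin 5) (Fin 5) ℝ) i := by
    ext j
    simp [Matrix.mulVec, dotProduct, Matrix.one_apply]
  simp only [hrow, gamma_conjMatrix_mulVec, conj_mul_conj] at h
  rw [re_trace_mul_comm, ← mul_assoc, Unitary.coe_star_mul_self, one_mul, h1,
    Matrix.det_transpose, Matrix.det_one] at h
  linarith

theorem conjMatrix_mem (A : Sp 2) : conjMatrix A.1 ∈ Matrix.specialOrthogonalGroup (Fin 5) ℝ :=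
  Matrix.mem_specialOrthogonalGroup_iff.mpr
    ⟨(Matrix.mem_orthogonalGroup_iff' _ _).mpr (conjMatrix_transpose_mul_self A), det_conjMatrix A⟩

/-- The double cover `Sp(2) → SO(5)`. -/
noncomputable def doubleCover : Sp 2 →* Matrix.specialOrthogonalGroup (Fin 5) ℝ where
  toFun A := ⟨conjMatrix A.1, conjMatrix_mem A⟩
  map_one' := Subtype.ext conjMatrix_one
  map_mul' A B := Subtype.ext (conjMatrix_mul A B)

theorem continuous_doubleCover : Continuous doubleCover := by
  refine Continuous.subtype_mk (continuous_matrix fun i j => ?_) _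
  have h (A : Sp 2) : conjMatrix A.1 i j =
      coords (A.1 * gamma (Pi.single j 1) * star A.1) i := by
    rw [← conjMatrix_mulVec, Matrix.mulVec_single_one, Matrix.col_apply]
  simp only [h]
  have hA : Continuous fun A : Sp 2 =>
      (A.1 * gamma (Pi.single j 1) * star A.1 : Matrix (Fin 2) (Fin 2) ℍ[ℝ]) :=
    (continuous_subtype_val.matrix_mul continuous_const).matrix_mul
      continuous_subtype_val.matrix_conjTranspose
  have h00 := hA.matrix_elem 0 0
  have h01 := hA.matrix_elem 0 1
  fin_cases i
  · exact Quaternion.continuous_re.comp h00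
  · exact Quaternion.continuous_re.comp h01
  · exact Quaternion.continuous_imI.comp h01
  · exact Quaternion.continuous_imJ.comp h01
  · exact Quaternion.continuous_imK.comp h01

theorem eq_one_or_neg_one_of_commute {A : Sp 2}
    (h : ∀ v, A.1 * gamma v = gamma v * A.1) : A = 1 ∨ A = -1 := by
  have e (k : Fin 5) (i j : Fin 2) :=
    Quaternion.ext_iff.mp (congr_fun (congr_fun (h (Pi.single k 1)) i) j)
  have h01 := e 0 0 1
  have h10 := e 0 1 0
  have h1 := e 1 0 1
  have h2 := e 2 0 1
  have h3 := e 3 0 1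
  simp [Matrix.mul_apply] at h01 h10 h1 h2 h3
  obtain ⟨r, hr⟩ : ∃ r : ℝ, A.1 = r • 1 := by
    refine ⟨(A.1 0 0).re, ?_⟩
    ext i j <;> fin_cases i <;> fin_cases j <;> simp <;> grind
  have hA := Unitary.mul_star_self_of_mem A.2
  have hrr := congr_arg (fun q : ℍ[ℝ] => q.re) (congr_fun (congr_fun hA 0) 0)
  simp [hr] at hrr
  rcases mul_self_eq_one_iff.mp hrr with rfl | rfl
  · exact Or.inl (Subtype.ext (by rw [hr, one_smul]; rfl))
  · exact Or.inr (Subtype.ext (by rw [hr, neg_smul, one_smul]; rfl))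

theorem ker_doubleCover : (doubleCover.ker : Set (Sp 2)) = {1, -1} := by
  ext A
  simp only [SetLike.mem_coe, MonoidHom.mem_ker, Set.mem_insert_iff, Set.mem_singleton_iff]
  constructor
  · intro hA
    have hA : conjMatrix A.1 = 1 := congr_arg Subtype.val hA
    refine eq_one_or_neg_one_of_commute fun v => ?_
    have h := gamma_conjMatrix_mulVec A v
    rw [hA, Matrix.one_mulVec] at h
    conv_rhs => rw [h]
    rw [mul_assoc, Unitary.coe_star_mul_self, mul_one]
  · rintro (rfl | rfl)
    · exact map_one _
    · refine Subtype.ext (eq_of_gamma_mulVec fun v => ?_)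
      exact (gamma_conjMatrix_mulVec (-1) v).trans (by
        simp [show ((-1 : Sp 2) : Matrix (Fin 2) (Fin 2) ℍ[ℝ]) = -1 from rfl])

/-- Up to sign, the orthogonal transformation `g` of `ℝ⁵` comes from an element of `Sp(2)`. -/
def LiftsUpToSign (g : EuclideanSpace ℝ (Fin 5) ≃ₗᵢ[ℝ] EuclideanSpace ℝ (Fin 5)) : Prop :=
  ∃ A : Sp 2, ∃ s : ℤˣ, ∀ x, (g x).ofLp = s • conjMatrix A.1 *ᵥ x.ofLp

theorem LiftsUpToSign.one : LiftsUpToSign 1 :=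
  ⟨1, 1, fun x => by simp [conjMatrix_one]⟩

theorem LiftsUpToSign.mul {g h : EuclideanSpace ℝ (Fin 5) ≃ₗᵢ[ℝ] EuclideanSpace ℝ (Fin 5)}
    (hg : LiftsUpToSign g) (hh : LiftsUpToSign h) : LiftsUpToSign (g * h) := by
  obtain ⟨A, s, hA⟩ := hg
  obtain ⟨B, t, hB⟩ := hh
  refine ⟨A * B, s * t, fun x => ?_⟩
  rw [LinearIsometryEquiv.coe_mul, Function.comp_apply, hA, hB, conjMatrix_mul,
    ← Matrix.mulVec_mulVec,
    Matrix.mulVec_smul, mul_smul]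

theorem gamma_mem_unitary {v : Fin 5 → ℝ} (h : v ⬝ᵥ v = 1) :
    gamma v ∈ unitary (Matrix (Fin 2) (Fin 2) ℍ[ℝ]) := by
  rw [Unitary.mem_iff, star_gamma, gamma_mul_self, h, one_smul, and_self]

theorem liftsUpToSign_reflection_of_norm_eq_one {u : EuclideanSpace ℝ (Fin 5)} (hu : ‖u‖ = 1) :
    LiftsUpToSign (ℝ ∙ u)ᗮ.reflection := by
  have hdot : u.ofLp ⬝ᵥ u.ofLp = 1 := by
    rw [← one_pow 2, ← hu, ← real_inner_self_eq_norm_sq, EuclideanSpace.inner_eq_star_dotProduct,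
      star_trivial]
  refine ⟨⟨gamma u, gamma_mem_unitary hdot⟩, -1, fun x => gamma_injective ?_⟩
  have hc := gamma_mul_add_mul u.ofLp x.ofLp
  rw [Submodule.reflection_orthogonal_apply, Submodule.reflection_singleton_apply, hu,
    Units.neg_smul, one_smul, map_neg, gamma_conjMatrix_mulVec, star_gamma, eq_sub_of_add_eq hc,
    sub_mul, mul_assoc, gamma_mul_self, hdot, smul_mul_assoc, one_mul,
    EuclideanSpace.inner_eq_star_dotProduct]
  simp [dotProduct_comm, two_mul, add_smul]

theorem liftsUpToSign_reflection (v : EuclideanSpace ℝ (Fin 5)) :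
    LiftsUpToSign (ℝ ∙ v)ᗮ.reflection := by
  by_cases hv : v = 0
  · refine ⟨1, 1, fun x => ?_⟩
    have hx : x ∈ (ℝ ∙ v)ᗮ := by simp [hv]
    rw [Submodule.reflection_mem_subspace_eq_self hx]
    simp [conjMatrix_one]
  · have hspan : (ℝ ∙ (‖v‖⁻¹ • v)) = ℝ ∙ v :=
      Submodule.span_singleton_smul_eq (by simpa using hv) v
    have h := liftsUpToSign_reflection_of_norm_eq_one (norm_smul_inv_norm (𝕜 := ℝ) hv)
    convert h using 3
    exact hspan.symm

theorem liftsUpToSign (g : EuclideanSpace ℝ (Fin 5) ≃ₗᵢ[ℝ] EuclideanSpace ℝ (Fin 5)) :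
    LiftsUpToSign g := by
  obtain ⟨l, -, rfl⟩ := g.reflections_generate_dim
  induction l with
  | nil => exact LiftsUpToSign.one
  | cons v l ih => exact (liftsUpToSign_reflection v).mul ih

theorem surjective_doubleCover : Function.Surjective doubleCover := by
  rintro ⟨R, hR⟩
  obtain ⟨hO, hdet⟩ := Matrix.mem_specialOrthogonalGroup_iff.mp hR
  have hO : Rᵀ * R = 1 := (Matrix.mem_orthogonalGroup_iff' _ _).mp hO
  have hiso (x : EuclideanSpace ℝ (Fin 5)) : ‖R.toEuclideanLin x‖ = ‖x‖ := by
    rw [← sq_eq_sq₀ (norm_nonneg _) (norm_nonneg _), ← real_inner_self_eq_norm_sq,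
      ← real_inner_self_eq_norm_sq, EuclideanSpace.inner_eq_star_dotProduct,
      EuclideanSpace.inner_eq_star_dotProduct, star_trivial, star_trivial,
      Matrix.ofLp_toLpLin, Matrix.toLin'_apply, Matrix.dotProduct_mulVec, ← Matrix.mulVec_transpose,
      Matrix.mulVec_mulVec, hO, Matrix.one_mulVec]
  obtain ⟨A, s, hA⟩ := liftsUpToSign
    ((⟨R.toEuclideanLin, hiso⟩ : _ →ₗᵢ[ℝ] _).toLinearIsometryEquiv rfl)
  have hRA : R = s • conjMatrix A.1 := Matrix.ext_iff_mulVec.mpr fun v => by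
    simpa [Matrix.smul_mulVec] using hA (WithLp.toLp 2 v)
  refine ⟨A, Subtype.ext ?_⟩
  obtain rfl | rfl := Int.units_eq_one_or s
  · rw [one_smul] at hRA
    exact hRA.symm
  · rw [hRA, Units.neg_smul, one_smul, Matrix.det_neg, det_conjMatrix] at hdet
    norm_num at hdet

end SpinFive

/-- There exists a surjective continuous group homomorphism `ρ : Sp(2) → SO(5, ℝ)` whose
kernel is exactly `{1, -1}`; in particular `Sp(2)/{±1} ≅ SO(5)` (coming from the
exceptional isomorphism `Sp(2) ≅ Spin(5)`). -/
theorem exists_Sp2_to_SO5 :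
    ∃ ρ : Sp 2 →* Matrix.specialOrthogonalGroup (Fin 5) ℝ,
      Continuous ρ ∧ Function.Surjective ρ ∧
      (MonoidHom.ker ρ : Set (Sp 2)) = {1, -1} := by
  exact ⟨SpinFive.doubleCover, SpinFive.continuous_doubleCover, SpinFive.surjective_doubleCover,
    SpinFive.ker_doubleCover⟩
end
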